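/- arXiv:2308.06837 — 3 statements merged into one kernel-verified Lean document; each statement's English description precedes it below -/
import Mathlib

section
/- (Algebraic-non-closedness lemma) Let H be a group that is finitely generated modulo its centre, b ∈ H, p prime, k ≥ 1, with b^{p^k} ∈ Z(H) but b^{p^k} not equal to z^{p^k} for any z ∈ Z(H). Let n be the maximal number of pairwise commuting subgroups whose product is H and none of which centralises the set {h ∈ H : h^{p^k} = 1, [h,b] = 1}. Suppose S and F are as in the verbal-closedness lemma and additionally for every subset T ⊆ S with |T| ≤ max(n,1) there is f_T ∈ F with f_T(s) = 1 for all s ∈ T. Then the diagonal copy of H in G = F ⋉ ∏_{s∈S} H_s is not algebraically closed in G. -/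
/-- The image of `f : H →* G` is an algebraically closed subgroup of `G`: every finite system
of equations with coefficients in `H` (elements of the free product `H ∗ F(x, y, …)`) which is
solvable in `G` is solvable in `H`. -/
def AlgebraicallyClosedHom {H G : Type} [Group H] [Group G] (f : H →* G) : Prop :=
  ∀ (m : ℕ) (eqs : Fin m → Monoid.Coprod H (FreeGroup ℕ)),
    (∃ φ : ℕ → G, ∀ i, Monoid.Coprod.lift f (FreeGroup.lift φ) (eqs i) = 1) →
    ∃ ψ : ℕ → H, ∀ i, Monoid.Coprod.lift (MonoidHom.id H) (FreeGroup.lift ψ) (eqs i) = 1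

/-- The diagonal homomorphism `H →* (S → H)`. -/
def diagPi (S H : Type) [Group H] : H →* (S → H) where
  toFun h := fun _ => h
  map_one' := rfl
  map_mul' _ _ := rfl

/-- `H` is a product of `n` pairwise commuting subgroups, none of which centralises the set
`{h : h ^ p ^ k = 1, [h, b] = 1}`. -/
def IsDecomp (H : Type) [Group H] (b : H) (p k : ℕ) (n : ℕ) : Prop :=
  ∃ K : Fin n → Subgroup H,
    (∀ i j, i ≠ j → ∀ x ∈ K i, ∀ y ∈ K j, x * y = y * x) ∧
    (⨆ i, K i) = ⊤ ∧
    ∀ i, ¬ K i ≤ Subgroup.centralizer {h : H | h ^ p ^ k = 1 ∧ h * b = b * h}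


theorem algClosed_solve {H G V ι : Type} [Group H] [Group G] [Countable V] [Finite ι]
    {f : H →* G} (hf : AlgebraicallyClosedHom f)
    (eqs : ι → Monoid.Coprod H (FreeGroup V)) (φ : V → G)
    (hφ : ∀ i, Monoid.Coprod.lift f (FreeGroup.lift φ) (eqs i) = 1) :
    ∃ ψ : V → H, ∀ i, Monoid.Coprod.lift (MonoidHom.id H) (FreeGroup.lift ψ) (eqs i) = 1 := by
  obtain ⟨e, he⟩ := exists_injective_nat V
  obtain ⟨m, ⟨g⟩⟩ := Finite.exists_equiv_fin ι
  have key : ∀ {K : Type} [Group K] (a : H →* K) (c : ℕ → K),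
      (Monoid.Coprod.lift a (FreeGroup.lift c)).comp
        (Monoid.Coprod.map (MonoidHom.id H) (FreeGroup.map e)) =
      Monoid.Coprod.lift a (FreeGroup.lift (fun v => c (e v))) := by
    intro K _ a c
    ext x <;> simp
  obtain ⟨ψ, hψ⟩ := hf m
    (fun i => Monoid.Coprod.map (MonoidHom.id H) (FreeGroup.map e) (eqs (g.symm i)))
    ⟨Function.extend e φ 1, fun i => by
      have h := DFunLike.congr_fun (key f (Function.extend e φ 1)) (eqs (g.symm i))
      rw [MonoidHom.comp_apply] at h
      rw [h]
      simp only [he.extend_apply]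
      exact hφ _⟩
  refine ⟨fun v => ψ (e v), fun i => ?_⟩
  have h := DFunLike.congr_fun (key (MonoidHom.id H) ψ) (eqs i)
  rw [MonoidHom.comp_apply] at h
  rw [← h]
  simpa using hψ (g i)

theorem list_prod_mulSingle {S H : Type} [DecidableEq S] [Group H] (t : H) (l : List S)
    (hl : l.Nodup) (s : S) :
    (l.map (fun r => (Pi.mulSingle r t : S → H))).prod s = if s ∈ l then t else 1 := by
  induction l with
  | nil => simp
  | cons a l ih =>
    rw [List.nodup_cons] at hl
    rw [List.map_cons, List.prod_cons, Pi.mul_apply, ih hl.2]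
    by_cases h : s = a
    · subst h
      simp [hl.1]
    · simp [h]

/-- The solution in `H` of the system gives a contradiction. -/
theorem no_solution (H : Type) [Group H] (p k : ℕ) (b : H)
    (T : Finset H) (hfg : Subgroup.closure (↑T : Set H) ⊔ Subgroup.center H = ⊤)
    (hnot : ∀ z ∈ Subgroup.center H, z ^ p ^ k ≠ b ^ p ^ k)
    (n : ℕ) (hmax : ∀ m, IsDecomp H b p k m → m ≤ n)
    (S : Type) [Fintype S] [Nonempty S] {F : Type} (ev : F → S → Prop)
    (hT : ∀ R : Finset S, R.card ≤ max n 1 → ∃ f : F, ∀ s ∈ R, ev f s)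
    (x : F → H) (h : S → T → H)
    (h1 : ∀ f, x f ^ p ^ k = 1) (h2 : ∀ f, x f * b = b * x f)
    (h3 : ∀ f s t, ev f s → x f * h s t * (x f)⁻¹ = b⁻¹ * h s t * b)
    (h4 : ∀ s s', s ≠ s' → ∀ t t', h s t * h s' t' = h s' t' * h s t)
    (h5 : ∀ t : T, (t : H) = ((Finset.univ : Finset S).toList.map (fun s => h s t)).prod) :
    False := by
  classical
  set C : Set H := {y : H | y ^ p ^ k = 1 ∧ y * b = b * y} with hC
  let K : S → Subgroup H := fun s => Subgroup.closure (Set.range (h s)) ⊔ Subgroup.center H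
  have hxC : ∀ f, x f ∈ C := fun f => ⟨h1 f, h2 f⟩
  have hhK : ∀ s t, h s t ∈ K s := fun s t =>
    (le_sup_left : _ ≤ K s) (Subgroup.subset_closure ⟨t, rfl⟩)
  have hcent : ∀ s (D : Set H), (∀ t, h s t ∈ Subgroup.centralizer D) →
      K s ≤ Subgroup.centralizer D := by
    intro s D hD
    refine sup_le ?_ (Subgroup.center_le_centralizer D)
    rw [Subgroup.closure_le]
    rintro _ ⟨t, rfl⟩
    exact hD t
  have hcomm : ∀ s s', s ≠ s' → ∀ y ∈ K s, ∀ y' ∈ K s', y * y' = y' * y := by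
    intro s s' hs y hy y' hy'
    have a1 : K s ≤ Subgroup.centralizer (K s' : Set H) := by
      refine hcent s _ fun t => ?_
      rw [Subgroup.mem_centralizer_iff]
      intro w hw
      have a2 : K s' ≤ Subgroup.centralizer {h s t} := by
        refine hcent s' _ fun t' => ?_
        rw [Subgroup.mem_centralizer_iff]
        rintro _ rfl
        exact h4 s s' hs t t'
      exact ((Subgroup.mem_centralizer_iff.1 (a2 hw)) _ rfl).symm
    exact ((Subgroup.mem_centralizer_iff.1 (a1 hy)) y' hy').symm
  have hsup : (⨆ s, K s) = ⊤ := by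
    rw [eq_top_iff, ← hfg]
    refine sup_le ?_ ?_
    · rw [Subgroup.closure_le]
      intro t ht
      have e := h5 ⟨t, ht⟩
      simp only at e
      rw [e]
      refine Subgroup.list_prod_mem _ ?_
      intro y hy
      obtain ⟨s, -, rfl⟩ := List.mem_map.1 hy
      exact (le_iSup K s) (hhK s _)
    · exact le_sup_right.trans (le_iSup K (Classical.arbitrary S))
  let R : Finset S := Finset.univ.filter fun s => ¬ K s ≤ Subgroup.centralizer C
  have hmemR : ∀ s, s ∈ R ↔ ¬ K s ≤ Subgroup.centralizer C := fun s => by simp [R]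
  have hcard : R.card ≤ max n 1 := by
    by_cases hR : R.Nonempty
    · refine le_trans (hmax _ ?_) (le_max_left _ _)
      obtain ⟨r0, hr0⟩ := hR
      -- merge the centralising factors into the one with index r0
      let c : S → S := fun s => if s ∈ R then s else r0
      have hc : ∀ s, c s ∈ R := fun s => by
        by_cases hs : s ∈ R <;> simp [c, hs, hr0]
      have hcR : ∀ s ∈ R, c s = s := fun s hs => by simp [c, hs]
      let L : S → Subgroup H := fun r => ⨆ s : {s : S // c s = r}, K s
      let e := R.equivFin
      have hLc : ∀ r r', r ≠ r' → ∀ y ∈ L r, ∀ y' ∈ L r', y * y' = y' * y := by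
        intro r r' hr y hy y' hy'
        have b1 : L r ≤ Subgroup.centralizer (L r' : Set H) := by
          refine iSup_le ?_
          rintro ⟨s, hs⟩ w hw
          rw [Subgroup.mem_centralizer_iff]
          intro w' hw'
          have b2 : L r' ≤ Subgroup.centralizer {w} := by
            refine iSup_le ?_
            rintro ⟨s', hs'⟩ v hv
            rw [Subgroup.mem_centralizer_iff]
            rintro _ rfl
            refine hcomm s s' ?_ _ hw _ hv
            rintro rfl
            exact hr (hs.symm.trans hs')
          exact ((Subgroup.mem_centralizer_iff.1 (b2 hw')) _ rfl).symm
        exact ((Subgroup.mem_centralizer_iff.1 (b1 hy)) y' hy').symm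
      refine ⟨fun i => L (e.symm i), ?_, ?_, ?_⟩
      · intro i j hij
        refine hLc _ _ ?_
        intro hh
        exact hij (e.symm.injective (Subtype.ext hh))
      · rw [eq_top_iff, ← hsup]
        refine iSup_le fun s => ?_
        have : K s ≤ L (c s) := le_iSup (fun s' : {s' : S // c s' = c s} => K s') ⟨s, rfl⟩
        refine this.trans ?_
        have := le_iSup (fun i => L (e.symm i)) (e ⟨c s, hc s⟩)
        simpa using this
      · intro i hle
        have hi := (e.symm i).2
        refine (hmemR _).1 hi (le_trans ?_ hle)
        exact le_iSup (fun s' : {s' : S // c s' = (e.symm i : S)} => K s') ⟨_, hcR _ hi⟩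
    · rw [Finset.not_nonempty_iff_eq_empty.1 hR]
      simp
  obtain ⟨f, hf⟩ := hT R hcard
  have hz : b * x f ∈ Subgroup.center H := by
    have hall : ∀ s, K s ≤ Subgroup.centralizer {b * x f} := by
      intro s
      refine hcent s _ fun t => ?_
      rw [Subgroup.mem_centralizer_iff]
      rintro _ rfl
      by_cases hs : s ∈ R
      · have e := h3 f s t (hf s hs)
        rw [mul_inv_eq_iff_eq_mul] at e
        rw [mul_assoc, e]
        group
      · have hs' : K s ≤ Subgroup.centralizer C := by
          by_contra hcon
          exact hs ((hmemR s).2 hcon)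
        have hx : ∀ g, x g * h s t = h s t * x g := fun g =>
          (Subgroup.mem_centralizer_iff.1 (hs' (hhK s t))) _ (hxC g)
        obtain ⟨g, hg⟩ := hT {s} (by simp)
        have e := h3 g s t (hg s (by simp))
        rw [hx g, mul_inv_cancel_right] at e
        have e2 : b * h s t = h s t * b := by
          nth_rewrite 1 [e]
          group
        rw [mul_assoc, hx f, ← mul_assoc, e2, mul_assoc]
    have htop : (⊤ : Subgroup H) ≤ Subgroup.centralizer {b * x f} := hsup ▸ iSup_le hall
    rw [Subgroup.mem_center_iff]
    intro g
    exact ((Subgroup.mem_centralizer_iff.1 (htop (Subgroup.mem_top g))) _ rfl).symm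
  refine hnot _ hz ?_
  have hc : Commute b (x f) := (h2 f).symm
  rw [hc.mul_pow, h1, mul_one]

/-- Variables of the system. -/
abbrev SysVar (F S T : Type) : Type := F ⊕ (S × T)

open Monoid.Coprod in
/-- The system of equations. -/
noncomputable def sysEq {H : Type} [Group H] (q : ℕ) (b : H) (S : Type) [Fintype S] (T : Finset H)
    {F : Type} :
    (F ⊕ F ⊕ (F × S × T) ⊕ (S × S × T × T) ⊕ T) →
      Monoid.Coprod H (FreeGroup (SysVar F S T))
  | .inl f => (inr (FreeGroup.of (.inl f))) ^ q
  | .inr (.inl f) => inr (FreeGroup.of (.inl f)) * inl b *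
      (inl b * inr (FreeGroup.of (.inl f)))⁻¹
  | .inr (.inr (.inl (f, s, t))) => inr (FreeGroup.of (.inl f)) * inr (FreeGroup.of (.inr (s, t))) *
      (inr (FreeGroup.of (.inl f)))⁻¹ *
      ((inl b)⁻¹ * inr (FreeGroup.of (.inr (s, t))) * inl b)⁻¹
  | .inr (.inr (.inr (.inl (s, s', t, t')))) =>
      inr (FreeGroup.of (.inr (s, t))) * inr (FreeGroup.of (.inr (s', t'))) *
      (inr (FreeGroup.of (.inr (s', t'))) * inr (FreeGroup.of (.inr (s, t))))⁻¹
  | .inr (.inr (.inr (.inr t))) => inl (t : H) *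
      (inr (((Finset.univ : Finset S).toList.map
        (fun s => FreeGroup.of (Sum.inr (s, t) : SysVar F S T))).prod))⁻¹

/-- Index set of the system: only the valid instances. -/
def sysValid {H : Type} (S : Type) (T : Finset H) {F : Type} (ev : F → S → Prop) :
    (F ⊕ F ⊕ (F × S × T) ⊕ (S × S × T × T) ⊕ T) → Prop
  | .inl _ => True
  | .inr (.inl _) => True
  | .inr (.inr (.inl (f, s, _))) => ev f s
  | .inr (.inr (.inr (.inl (s, s', _, _)))) => s ≠ s'
  | .inr (.inr (.inr (.inr _))) => True

/-- Algebraic-non-closedness lemma: with `H` finitely generated modulo its centre,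
`b ^ p ^ k` central but not a `p^k`-th power of a central element, `n` the maximal number of
pairwise commuting subgroups with product `H` none of which centralises
`{h : h ^ p ^ k = 1, [h, b] = 1}`, and `S`, `F` as in the verbal-closedness lemma such that
moreover every subset `T ⊆ S` with `|T| ≤ max n 1` admits `f_T ∈ F` equal to `1` on `T`,
the diagonal copy of `H` in `G = F ⋉ ∏_{s ∈ S} H_s` is not algebraically closed in `G`. -/
theorem algebraic_non_closedness_lemma (H : Type) [Group H] (p k : ℕ)
    (hp : p.Prime) (hk : 1 ≤ k) (b : H)
    (hfg : ∃ T : Finset H, Subgroup.closure (↑T : Set H) ⊔ Subgroup.center H = ⊤)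
    (hb : b ^ p ^ k ∈ Subgroup.center H)
    (hnot : ∀ z ∈ Subgroup.center H, z ^ p ^ k ≠ b ^ p ^ k)
    (n : ℕ)
    (hmax : ∀ m, IsDecomp H b p k m → m ≤ n)
    (hn : IsDecomp H b p k n ∨ ∀ m, ¬ IsDecomp H b p k m)
    (S : Type) [Fintype S] (F : AddSubgroup (S → ZMod (p ^ k)))
    (hvanish : ∀ f : F, ∃ s : S, (f : S → ZMod (p ^ k)) s = 0)
    (hT : ∀ T : Finset S, T.card ≤ max n 1 →
      ∃ f : F, ∀ s ∈ T, (f : S → ZMod (p ^ k)) s = 1)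
    (φ : Multiplicative F →* MulAut (S → H))
    (hφ : ∀ (f : F) (d : S → H) (s : S) (j : ℤ),
      (j : ZMod (p ^ k)) = (f : S → ZMod (p ^ k)) s →
      φ (Multiplicative.ofAdd f) d s = b ^ (-j) * d s * b ^ j) :
    ¬ AlgebraicallyClosedHom
      ((SemidirectProduct.inl : (S → H) →* (S → H) ⋊[φ] Multiplicative F).comp (diagPi S H)) := by
  classical
  intro hcl
  obtain ⟨T, hTg⟩ := hfg
  have hq : 1 < p ^ k := Nat.one_lt_pow (by omega) hp.one_lt
  haveI : NeZero (p ^ k) := ⟨by omega⟩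
  haveI : Finite F := inferInstance
  haveI : Nonempty S := ⟨(hvanish 0).choose⟩
  let ev : F → S → Prop := fun f s => (f : S → ZMod (p ^ k)) s = 1
  have hconst : ∀ f : F, φ (Multiplicative.ofAdd f) (diagPi S H b) = diagPi S H b := by
    intro f
    funext s
    obtain ⟨j, hj⟩ := ZMod.intCast_surjective ((f : S → ZMod (p ^ k)) s)
    rw [hφ f _ s j hj]
    change b ^ (-j) * b * b ^ j = b
    group
  have hsingle : ∀ (f : F) (s : S) (t : H), ev f s →
      φ (Multiplicative.ofAdd f) (Pi.mulSingle s t) =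
        (diagPi S H b)⁻¹ * Pi.mulSingle s t * diagPi S H b := by
    intro f s t hev
    funext s'
    change _ = b⁻¹ * (Pi.mulSingle s t : S → H) s' * b
    by_cases hs : s' = s
    · subst hs
      rw [hφ f _ s' 1 (by rw [Int.cast_one]; exact hev.symm)]
      simp
    · obtain ⟨j, hj⟩ := ZMod.intCast_surjective ((f : S → ZMod (p ^ k)) s')
      rw [hφ f _ s' j hj]
      simp [hs]
  let sol : SysVar F S T → (S → H) ⋊[φ] Multiplicative F := fun v =>
    Sum.elim (fun f => SemidirectProduct.inr (Multiplicative.ofAdd f))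
      (fun st => SemidirectProduct.inl (Pi.mulSingle st.1 (st.2 : H))) v
  obtain ⟨ψ, hψ⟩ := algClosed_solve hcl
    (fun i : {i // sysValid S T ev i} => sysEq (p ^ k) b S T i.1) sol (by
      rintro ⟨f | f | ⟨f, s, t⟩ | ⟨s, s', t, t'⟩ | t, hi⟩
      · simp only [sysEq, map_pow, Monoid.Coprod.lift_apply_inr, FreeGroup.lift_apply_of, sol,
          Sum.elim_inl]
        rw [← map_pow, ← ofAdd_nsmul]
        have : p ^ k • f = 0 := by
          ext s
          simp
        rw [this]
        simp
      · simp only [sysEq, map_mul, map_inv, Monoid.Coprod.lift_apply_inr,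
          Monoid.Coprod.lift_apply_inl, FreeGroup.lift_apply_of, sol, Sum.elim_inl]
        rw [mul_inv_eq_one, ← mul_inv_eq_iff_eq_mul, MonoidHom.comp_apply, ← map_inv,
          ← SemidirectProduct.inl_aut, hconst]
      · have hev : ev f s := hi
        simp only [sysEq, map_mul, map_inv, Monoid.Coprod.lift_apply_inr,
          Monoid.Coprod.lift_apply_inl, FreeGroup.lift_apply_of, sol, Sum.elim_inl, Sum.elim_inr]
        rw [mul_inv_eq_one, MonoidHom.comp_apply, ← map_inv,
          ← SemidirectProduct.inl_aut, hsingle f s t hev]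
        simp
      · have hne : s ≠ s' := hi
        simp only [sysEq, map_mul, map_inv, Monoid.Coprod.lift_apply_inr,
          FreeGroup.lift_apply_of, sol, Sum.elim_inr]
        rw [mul_inv_eq_one, ← map_mul, ← map_mul]
        congr 1
        exact Pi.mulSingle_commute hne _ _
      · simp only [sysEq, map_mul, map_inv, Monoid.Coprod.lift_apply_inr,
          Monoid.Coprod.lift_apply_inl, map_list_prod, List.map_map]
        rw [mul_inv_eq_one, MonoidHom.comp_apply]
        have e : diagPi S H t =
            ((Finset.univ : Finset S).toList.map (fun r => (Pi.mulSingle r (t : H) : S → H))).prod := by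
          funext s
          rw [list_prod_mulSingle _ _ (Finset.nodup_toList _)]
          simp [diagPi]
        rw [e, map_list_prod, List.map_map]
        congr 1
        refine List.map_congr_left fun s _ => ?_
        simp [sol])
  refine no_solution H p k b T hTg hnot n hmax S ev hT (fun f => ψ (.inl f))
    (fun s t => ψ (.inr (s, t))) ?_ ?_ ?_ ?_ ?_
  · intro f
    have := hψ ⟨.inl f, trivial⟩
    simpa [sysEq] using this
  · intro f
    have := hψ ⟨.inr (.inl f), trivial⟩
    simp only [sysEq, map_mul, map_inv, Monoid.Coprod.lift_apply_inr,
          Monoid.Coprod.lift_apply_inl, FreeGroup.lift_apply_of, MonoidHom.id_apply] at this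
    exact mul_inv_eq_one.1 this
  · intro f s t hev
    have := hψ ⟨.inr (.inr (.inl (f, s, t))), hev⟩
    simp only [sysEq, map_mul, map_inv, Monoid.Coprod.lift_apply_inr,
          Monoid.Coprod.lift_apply_inl, FreeGroup.lift_apply_of, MonoidHom.id_apply] at this
    exact mul_inv_eq_one.1 this
  · intro s s' hs t t'
    have := hψ ⟨.inr (.inr (.inr (.inl (s, s', t, t')))), hs⟩
    simp only [sysEq, map_mul, map_inv, Monoid.Coprod.lift_apply_inr,
          FreeGroup.lift_apply_of] at this
    exact mul_inv_eq_one.1 this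
  · intro t
    have := hψ ⟨.inr (.inr (.inr (.inr t))), trivial⟩
    simp only [sysEq, map_mul, map_inv, Monoid.Coprod.lift_apply_inr,
          Monoid.Coprod.lift_apply_inl, MonoidHom.id_apply, map_list_prod, List.map_map] at this
    rw [mul_inv_eq_one] at this
    rw [this]
    congr 1
    refine List.map_congr_left fun s _ => ?_
    simp
end

section
/- (Main theorem) Let H be a strongly verbally closed group that is finitely generated modulo its centre, p a prime, k ≥ 1, and b ∈ H with b^{p^k} ∈ Z(H) but b^{p^k} ≠ z^{p^k} for all z ∈ Z(H). Then for every positive integer n, H decomposes as a product of n pairwise commuting subgroups none of which is contained in the centraliser of the set {h ∈ H : h^{p^k} = 1, [h,b] = 1}; in particular, this set is not contained in Z(H). -/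
/-- The image of `f : H →* G` is a verbally closed subgroup of `G`: every equation
`w(x, y, …) = h` with `h ∈ H` which is solvable in `G` is solvable in `H`. -/
def VerballyClosedHom {H G : Type} [Group H] [Group G] (f : H →* G) : Prop :=
  ∀ (w : FreeGroup ℕ) (h : H),
    (∃ φ : ℕ → G, FreeGroup.lift φ w = f h) → ∃ ψ : ℕ → H, FreeGroup.lift ψ w = h

/-- A group `H` is strongly verbally closed if it is algebraically closed in every group
containing it as a verbally closed subgroup. -/
def StronglyVerballyClosed (H : Type) [Group H] : Prop :=
  ∀ (G : Type) [Group G] (f : H →* G), Function.Injective f →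
    VerballyClosedHom f → AlgebraicallyClosedHom f


theorem line_inter {α ι : Type} (L M : Combinatorics.Line α ι) (a b a' b' : α) (hab : a ≠ b)
    (h1 : L a = M a') (h2 : L b = M b') : L = M := by
  have key : ∀ i, L.idxFun i = M.idxFun i := by
    obtain ⟨i0, hi0⟩ := L.proper
    obtain ⟨j0, hj0⟩ := M.proper
    have e1 : ∀ i, (L.idxFun i).getD a = (M.idxFun i).getD a' := fun i => congrFun h1 i
    have e2 : ∀ i, (L.idxFun i).getD b = (M.idxFun i).getD b' := fun i => congrFun h2 i
    have k0 : M.idxFun i0 = none := by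
      rcases hM : M.idxFun i0 with _ | c
      · rfl
      · have := e1 i0; have := e2 i0; simp_all
    have ha : a = a' := by have := e1 i0; simp_all
    have hb : b = b' := by have := e2 i0; simp_all
    subst ha hb
    intro i
    have := e1 i; have := e2 i
    rcases hM : M.idxFun i with _ | c <;> rcases hL : L.idxFun i with _ | d <;> simp_all
  cases L; cases M; congr; funext i; exact key i

theorem code_exists (q n : ℕ) (hq : 0 < q) (hn : 1 ≤ n) :
    ∃ (X W : Type) (_ : Fintype X) (_ : Fintype W) (ε : X → (W → ℤ) →+ ℤ),
      (∀ g : W → ℤ, ∃ L, ∃ u : W → ℤ, ε L g + q * ∑ w, u w * g w = 0) ∧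
      (∀ S : Finset X, S.card ≤ n → ∃ P : W → Bool, ∀ s ∈ S,
        ε s (fun w => if P w then 1 else 0) = 1) := by
  classical
  have : NeZero q := ⟨hq.ne'⟩
  obtain ⟨ι, hι, hmono⟩ := Combinatorics.Line.exists_mono_in_high_dimension (Fin (q * n)) (ZMod q)
  have hfin : Finite (Combinatorics.Line (Fin (q * n)) ι) := by
    apply Finite.of_injective (fun L : Combinatorics.Line (Fin (q * n)) ι => L.idxFun)
    intro L M h
    cases L; cases M; congr
  refine ⟨Combinatorics.Line (Fin (q * n)) ι, ι → Fin (q * n), Fintype.ofFinite _, inferInstance,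
    fun L => AddMonoidHom.mk' (fun g => ∑ a, g (L a))
      (by intro g h; simp [Finset.sum_add_distrib]), ?_, ?_⟩
  · intro g
    obtain ⟨d, hd⟩ := IsPrincipalIdealRing.principal (Ideal.span (Set.range g))
    have hg : ∀ w, ∃ g', g w = d * g' := by
      intro w
      have : g w ∈ Ideal.span (Set.range g) := Ideal.subset_span ⟨w, rfl⟩
      rw [hd] at this
      exact Ideal.mem_span_singleton.1 this
    choose g' hg' using hg
    have hdm : d ∈ Ideal.span (Set.range g) := by
      rw [hd]; exact Ideal.mem_span_singleton_self d
    obtain ⟨u, hu⟩ := (Ideal.mem_span_range_iff_exists_fun).1 hdm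
    obtain ⟨L, c, hc⟩ := hmono (fun w => (g' w : ZMod q))
    have hdiv : (q : ℤ) ∣ ∑ a, g' (L a) := by
      rw [← ZMod.intCast_zmod_eq_zero_iff_dvd]
      push_cast
      simp [hc]
    obtain ⟨t, ht⟩ := hdiv
    refine ⟨L, fun w => -t * u w, ?_⟩
    have e1 : ∑ a, g (L a) = d * (q * t) := by
      rw [← ht, Finset.mul_sum]; exact Finset.sum_congr rfl fun a _ => hg' _
    have e2 : ∑ w, -t * u w * g w = -t * d := by
      rw [← hu, Finset.mul_sum]; exact Finset.sum_congr rfl fun a _ => by ring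
    show ∑ a, g (L a) + _ = 0
    rw [e1, e2]; ring
  · intro S hS
    have hpriv : ∀ s ∈ S, ∃ a, ∀ s' ∈ S, s' ≠ s → ∀ a', s' a' ≠ s a := by
      intro s hs
      by_contra hcon
      push Not at hcon
      choose F hF hFs F' hF' using hcon
      have hinj : Function.Injective F := by
        intro a b hab
        by_contra hne
        apply hFs a
        refine (line_inter s (F a) a b (F' a) (F' b) hne (hF' a).symm ?_).symm
        rw [hab]; exact (hF' b).symm
      have : Fintype.card (Fin (q * n)) ≤ (S.erase s).card := by
        rw [← Finset.card_univ]
        apply Finset.card_le_card_of_injOn F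
        · intro a _; simp [hF a, hFs a]
        · exact hinj.injOn
      rw [Finset.card_erase_of_mem hs, Fintype.card_fin] at this
      have hc : 0 < S.card := Finset.card_pos.2 ⟨s, hs⟩
      have : n ≤ q * n := Nat.le_mul_of_pos_left n hq
      omega
    have hne : Nonempty (Fin (q * n)) := ⟨⟨0, Nat.mul_pos hq hn⟩⟩
    choose! x hx using hpriv
    refine ⟨fun w => decide (∃ s ∈ S, w = s (x s)), ?_⟩
    intro s hs
    show ∑ a : Fin (q * n), (if decide (∃ s' ∈ S, s a = s' (x s')) = true then (1 : ℤ) else 0) = 1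
    rw [Finset.sum_eq_single (x s)]
    · simp only [decide_eq_true_eq]
      rw [if_pos ⟨s, hs, rfl⟩]
    · intro a _ ha
      simp only [decide_eq_true_eq]
      rw [if_neg]
      rintro ⟨s', hs', h⟩
      by_cases hss : s' = s
      · subst hss
        obtain ⟨i, hi⟩ := s'.proper
        have := congrFun h i
        rw [Combinatorics.Line.apply_none _ _ _ hi, Combinatorics.Line.apply_none _ _ _ hi] at this
        exact ha this
      · exact hx s' hs' s hs (Ne.symm hss) a h
    · simp

theorem algClosed_finite {H G : Type} [Group H] [Group G] (f : H →* G)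
    (hf : AlgebraicallyClosedHom f)
    (V : Type) [Finite V] (E : Set (Monoid.Coprod H (FreeGroup V))) (hE : E.Finite)
    (φ : V → G) (hφ : ∀ e ∈ E, Monoid.Coprod.lift f (FreeGroup.lift φ) e = 1) :
    ∃ ψ : V → H, ∀ e ∈ E, Monoid.Coprod.lift (MonoidHom.id H) (FreeGroup.lift ψ) e = 1 := by
  classical
  obtain ⟨N, ⟨en⟩⟩ := Finite.exists_equiv_fin V
  have := hE.fintype
  let em : Fin (Fintype.card E) ≃ E := (Fintype.equivFin E).symm
  let j : V → ℕ := fun v => (en v : ℕ)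
  have hj : Function.Injective j := fun a b h => en.injective (Fin.ext h)
  let J : Monoid.Coprod H (FreeGroup V) →* Monoid.Coprod H (FreeGroup ℕ) :=
    Monoid.Coprod.map (MonoidHom.id H) (FreeGroup.map j)
  have hJ : ∀ {K : Type} [Group K] (k : H →* K) (θ : ℕ → K) (e : Monoid.Coprod H (FreeGroup V)),
      Monoid.Coprod.lift k (FreeGroup.lift θ) (J e)
        = Monoid.Coprod.lift k (FreeGroup.lift (θ ∘ j)) e := by
    intro K _ k θ e
    have : (Monoid.Coprod.lift k (FreeGroup.lift θ)).comp J
        = Monoid.Coprod.lift k (FreeGroup.lift (θ ∘ j)) := by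
      apply Monoid.Coprod.hom_ext
      · ext x; simp [J]
      · ext x; simp [J]
    exact DFunLike.congr_fun this e
  obtain ⟨ψ, hψ⟩ := hf (Fintype.card E) (fun i => J (em i)) ⟨Function.extend j φ 1, by
    intro i
    rw [hJ, Function.extend_comp hj]
    exact hφ _ (em i).2⟩
  refine ⟨ψ ∘ j, fun e he => ?_⟩
  have := hψ (em.symm ⟨e, he⟩)
  rw [hJ] at this
  simpa using this

/-- The homomorphism whose range is the central subgroup used in the construction. -/
def ctrHom {H I A : Type} [Group H] [AddCommGroup A] (c : H) (M : A →+ (I → ℤ)) :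
    Multiplicative A →* (I → H) where
  toFun g := fun i => c ^ (M g.toAdd i)
  map_one' := by funext i; simp
  map_mul' := by intro x y; funext i; simp [zpow_add]

theorem ctrHom_normal {H I A : Type} [Group H] [AddCommGroup A] (c : H)
    (hc : c ∈ Subgroup.center H) (M : A →+ (I → ℤ)) : (ctrHom c M).range.Normal := by
  constructor
  rintro _ ⟨g, rfl⟩ x
  refine ⟨g, ?_⟩
  funext i
  have h := Subgroup.mem_center_iff.1 (Subgroup.zpow_mem _ hc (M g.toAdd i)) (x i)
  show c ^ (M g.toAdd i) = x i * c ^ (M g.toAdd i) * (x i)⁻¹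
  rw [h]; group

theorem diag_closed {H I A : Type} [Group H] [AddCommGroup A] (c : H)
    (M : A →+ (I → ℤ)) (hM : ∀ g, ∃ i, M g i = 0)
    (N : Subgroup (I → H)) [N.Normal] (hN : N = (ctrHom c M).range)
    (f : H →* (I → H) ⧸ N) (hf : ∀ h, f h = QuotientGroup.mk' N (fun _ => h)) :
    Function.Injective f ∧ VerballyClosedHom f := by
  have key : ∀ x ∈ N, ∃ i, x i = 1 := by
    intro x hx
    rw [hN] at hx
    obtain ⟨g, rfl⟩ := hx
    obtain ⟨i, hi⟩ := hM g.toAdd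
    exact ⟨i, by show c ^ (M g.toAdd i) = 1; rw [hi, zpow_zero]⟩
  constructor
  · rw [injective_iff_map_eq_one]
    intro h hh
    rw [hf, QuotientGroup.mk'_apply, QuotientGroup.eq_one_iff] at hh
    obtain ⟨i, hi⟩ := key _ hh
    exact hi
  · rintro w h ⟨φ, hφ⟩
    choose x hx using fun n => QuotientGroup.mk'_surjective N (φ n)
    have h1 : FreeGroup.lift φ w = QuotientGroup.mk' N (FreeGroup.lift x w) := by
      have : FreeGroup.lift φ = (QuotientGroup.mk' N).comp (FreeGroup.lift x) := by
        ext n; simpa using (hx n).symm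
      rw [this]; rfl
    rw [h1, hf] at hφ
    have h2 : (FreeGroup.lift x w)⁻¹ * (fun _ => h) ∈ N := QuotientGroup.eq.1 hφ
    obtain ⟨i, hi⟩ := key _ h2
    refine ⟨fun n => x n i, ?_⟩
    have h3 : FreeGroup.lift (fun n => x n i) = (Pi.evalMonoidHom (fun _ => H) i).comp
        (FreeGroup.lift x) := by
      ext n; simp
    rw [h3]
    exact (inv_mul_eq_one.1 hi)

theorem list_prod_ite {X H : Type} [DecidableEq X] [Monoid H] (l : List X) (hl : l.Nodup) (L : X)
    (hL : L ∈ l) (F : X → H) : (l.map fun M => if L = M then F M else 1).prod = F L := by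
  have hz : ∀ l : List X, L ∉ l → (l.map fun M => if L = M then F M else 1).prod = 1 := by
    intro l h
    apply List.prod_eq_one
    intro x hx
    obtain ⟨M, hM, rfl⟩ := List.mem_map.1 hx
    rw [if_neg]; rintro rfl; exact h hM
  induction l with
  | nil => simp at hL
  | cons a l ih =>
    rw [List.nodup_cons] at hl
    rw [List.map_cons, List.prod_cons]
    by_cases h : L = a
    · subst h
      rw [hz l hl.1]; simp
    · rw [if_neg h, one_mul]
      exact ih hl.2 (by simpa [h] using hL)

theorem system_solution (H : Type) [Group H] (hsvc : StronglyVerballyClosed H) (T : Finset H)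
    (q : ℕ) (b : H) (hb : b ^ q ∈ Subgroup.center H) {X W : Type} [Fintype X] [Fintype W]
    (ε : X → (W → ℤ) →+ ℤ)
    (hε : ∀ g : W → ℤ, ∃ L, ∃ u : W → ℤ, ε L g + q * ∑ w, u w * g w = 0)
    (l : List X) (hl : l.Nodup) (hlm : ∀ L, L ∈ l) :
    ∃ (t : X → T → H) (β : X → H) (z : (W → Bool) → H),
      (∀ τ : T, (l.map fun L => t L τ).prod = τ) ∧
      (l.map β).prod = b ∧
      (∀ L L' τ τ', L ≠ L' → t L τ * t L' τ' = t L' τ' * t L τ) ∧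
      (∀ L L', β L * β L' = β L' * β L) ∧
      (∀ L L' τ, L ≠ L' → t L τ * β L' = β L' * t L τ) ∧
      (∀ P, ∀ τ : T, z P * τ = τ * z P) ∧
      (∀ P : W → Bool, ((l.map fun L => β L ^ ε L (fun w => if P w then 1 else 0)).prod) ^ q
        * z P ^ q = 1) := by
  classical
  let I := X × (W → ℤ)
  let M : (W → ℤ) →+ (I → ℤ) := AddMonoidHom.mk'
    (fun g i => ε i.1 g + q * ∑ w, i.2 w * g w) (by
      intro g h; funext i; simp [mul_add, Finset.sum_add_distrib]; ring)
  let N : Subgroup (I → H) := (ctrHom (b ^ q) M).range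
  have hNn : N.Normal := ctrHom_normal _ hb M
  let π := QuotientGroup.mk' N
  let dg : H →* (I → H) := Pi.constMonoidHom I H
  let f : H →* (I → H) ⧸ N := π.comp dg
  obtain ⟨hinj, hvc⟩ := diag_closed (b ^ q) M (fun g => by
    obtain ⟨L, u, h⟩ := hε g; exact ⟨(L, u), h⟩) N rfl f (fun h => rfl)
  have hac := hsvc _ f hinj hvc
  let vt : X → T → Monoid.Coprod H (FreeGroup ((X × T) ⊕ X ⊕ (W → Bool))) := fun L τ => Monoid.Coprod.inr (FreeGroup.of (Sum.inl (L, τ)))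
  let vb : X → Monoid.Coprod H (FreeGroup ((X × T) ⊕ X ⊕ (W → Bool))) := fun L => Monoid.Coprod.inr (FreeGroup.of (Sum.inr (Sum.inl L)))
  let vz : (W → Bool) → Monoid.Coprod H (FreeGroup ((X × T) ⊕ X ⊕ (W → Bool))) := fun P => Monoid.Coprod.inr (FreeGroup.of (Sum.inr (Sum.inr P)))
  let cf : H → Monoid.Coprod H (FreeGroup ((X × T) ⊕ X ⊕ (W → Bool))) := fun h => Monoid.Coprod.inl h
  let cm : Monoid.Coprod H (FreeGroup ((X × T) ⊕ X ⊕ (W → Bool))) → Monoid.Coprod H (FreeGroup ((X × T) ⊕ X ⊕ (W → Bool))) → Monoid.Coprod H (FreeGroup ((X × T) ⊕ X ⊕ (W → Bool))) := fun x y => x * y * (y * x)⁻¹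
  let E1 : T → Monoid.Coprod H (FreeGroup ((X × T) ⊕ X ⊕ (W → Bool))) := fun τ => (l.map fun L => vt L τ).prod * (cf τ)⁻¹
  let E2 : Monoid.Coprod H (FreeGroup ((X × T) ⊕ X ⊕ (W → Bool))) := (l.map vb).prod * (cf b)⁻¹
  let E3 : X × X × T × T → Monoid.Coprod H (FreeGroup ((X × T) ⊕ X ⊕ (W → Bool))) := fun a => if a.1 ≠ a.2.1 then
    cm (vt a.1 a.2.2.1) (vt a.2.1 a.2.2.2) else 1
  let E4 : X × X → Monoid.Coprod H (FreeGroup ((X × T) ⊕ X ⊕ (W → Bool))) := fun a => cm (vb a.1) (vb a.2)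
  let E5 : X × X × T → Monoid.Coprod H (FreeGroup ((X × T) ⊕ X ⊕ (W → Bool))) := fun a => if a.1 ≠ a.2.1 then cm (vt a.1 a.2.2) (vb a.2.1) else 1
  let E6 : (W → Bool) × T → Monoid.Coprod H (FreeGroup ((X × T) ⊕ X ⊕ (W → Bool))) := fun a => cm (vz a.1) (cf a.2)
  let E7 : (W → Bool) → Monoid.Coprod H (FreeGroup ((X × T) ⊕ X ⊕ (W → Bool))) := fun P =>
    ((l.map fun L => vb L ^ ε L (fun w => if P w then 1 else 0)).prod) ^ q * vz P ^ q
  let E : Set (Monoid.Coprod H (FreeGroup ((X × T) ⊕ X ⊕ (W → Bool)))) := Set.range E1 ∪ ({E2} ∪ (Set.range E3 ∪ (Set.range E4 ∪ (Set.range E5 ∪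
    (Set.range E6 ∪ Set.range E7)))))
  have hEf : E.Finite := by
    refine (Set.finite_range _).union ((Set.finite_singleton _).union ((Set.finite_range _).union
      ((Set.finite_range _).union ((Set.finite_range _).union ((Set.finite_range _).union
      (Set.finite_range _))))))
  -- a solution in the big group
  let φt : X → T → (I → H) := fun L τ i => if i.1 = L then (τ : H) else 1
  let φb : X → (I → H) := fun L i => if i.1 = L then b else 1
  let φz : (W → Bool) → (I → H) := fun P i =>
    (b ^ q) ^ (∑ w, i.2 w * (if P w then 1 else 0 : ℤ))
  let φ0 : ((X × T) ⊕ X ⊕ (W → Bool)) → (I → H) := Sum.elim (fun a => φt a.1 a.2) (Sum.elim φb φz)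
  let Φ0 : Monoid.Coprod H (FreeGroup ((X × T) ⊕ X ⊕ (W → Bool))) →* (I → H) := Monoid.Coprod.lift dg (FreeGroup.lift φ0)
  have hΦ : ∀ e : Monoid.Coprod H (FreeGroup ((X × T) ⊕ X ⊕ (W → Bool))), Monoid.Coprod.lift f (FreeGroup.lift (fun v => π (φ0 v))) e = π (Φ0 e) := by
    intro e
    have : Monoid.Coprod.lift f (FreeGroup.lift (fun v => π (φ0 v))) = π.comp Φ0 := by
      apply Monoid.Coprod.hom_ext
      · ext x; simp [Φ0, f]
      · ext x; simp [Φ0]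
    rw [this]; rfl
  have ht : ∀ L τ, Φ0 (vt L τ) = φt L τ := by intro L τ; simp [Φ0, vt, φ0]
  have hbb : ∀ L, Φ0 (vb L) = φb L := by intro L; simp [Φ0, vb, φ0]
  have hz : ∀ P, Φ0 (vz P) = φz P := by intro L; simp [Φ0, vz, φ0]
  have hcf : ∀ h, Φ0 (cf h) = fun _ => h := by intro h; simp [Φ0, cf]; rfl
  have hcm : ∀ x y, Φ0 x * Φ0 y = Φ0 y * Φ0 x → Φ0 (cm x y) = 1 := by
    intro x y h
    simp only [cm]
    rw [map_mul, map_inv, map_mul, map_mul, h, mul_inv_cancel]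
  obtain ⟨ψ, hψ⟩ := algClosed_finite f hac ((X × T) ⊕ X ⊕ (W → Bool)) E hEf (fun v => π (φ0 v)) (by
    intro e he
    rw [hΦ]
    suffices h : Φ0 e ∈ N by
      exact (QuotientGroup.eq_one_iff _).2 h
    have evp : ∀ (F : X → Monoid.Coprod H (FreeGroup ((X × T) ⊕ X ⊕ (W → Bool)))) (i : I), Φ0 ((l.map F).prod) i = (l.map fun L => Φ0 (F L) i).prod := by
      intro F i
      rw [map_list_prod, List.map_map]
      have := map_list_prod (Pi.evalMonoidHom (fun _ : I => H) i) (l.map (Φ0 ∘ F))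
      rw [List.map_map] at this
      exact this
    rcases he with ⟨τ, rfl⟩ | rfl | ⟨a, rfl⟩ | ⟨a, rfl⟩ | ⟨a, rfl⟩ | ⟨a, rfl⟩ | ⟨P, rfl⟩
    · convert N.one_mem
      rw [map_mul, map_inv, mul_inv_eq_one, hcf]
      funext i
      rw [evp]
      simp only [ht, φt]
      exact list_prod_ite l hl i.1 (hlm _) (fun _ => (τ : H))
    · convert N.one_mem
      rw [map_mul, map_inv, mul_inv_eq_one, hcf]
      funext i
      rw [evp]
      simp only [hbb, φb]
      exact list_prod_ite l hl i.1 (hlm _) (fun _ => b)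
    · convert N.one_mem
      simp only [E3]
      split_ifs with h
      · apply hcm
        rw [ht, ht]
        funext i
        simp only [Pi.mul_apply, φt]
        split_ifs with h1 h2
        · exact absurd (h1.symm.trans h2) h
        all_goals simp
      · simp
    · convert N.one_mem
      apply hcm
      rw [hbb, hbb]
      funext i
      simp only [Pi.mul_apply, φb]
      split_ifs with h1 h2 <;> simp
    · convert N.one_mem
      simp only [E5]
      split_ifs with h
      · apply hcm
        rw [ht, hbb]
        funext i
        simp only [Pi.mul_apply, φt, φb]
        split_ifs with h1 h2
        · exact absurd (h1.symm.trans h2) h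
        all_goals simp
      · simp
    · convert N.one_mem
      apply hcm
      rw [hz, hcf]
      funext i
      simp only [Pi.mul_apply, φz]
      exact (Subgroup.mem_center_iff.1 (Subgroup.zpow_mem _ hb _) _).symm
    · refine ⟨Multiplicative.ofAdd (fun w => if P w then 1 else 0), ?_⟩
      funext i
      simp only [E7]
      rw [map_mul, map_pow, map_pow, Pi.mul_apply, Pi.pow_apply, Pi.pow_apply, evp]
      have : (l.map fun L => Φ0 (vb L ^ ε L (fun w => if P w then 1 else 0)) i).prod
          = b ^ ε i.1 (fun w => if P w then 1 else 0) := by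
        rw [← list_prod_ite l hl i.1 (hlm _) (fun L => b ^ ε L (fun w => if P w then 1 else 0))]
        congr 2
        funext L
        rw [map_zpow, Pi.pow_apply, hbb]
        simp only [φb]
        split_ifs <;> simp
      rw [this, hz]
      show (b ^ q) ^ (ε i.1 (fun w => if P w then 1 else 0)
        + q * ∑ w, i.2 w * (if P w then 1 else 0 : ℤ)) = _
      simp only [φz]
      rw [zpow_add]
      congr 1
      · rw [← zpow_natCast, ← zpow_mul, ← zpow_natCast, ← zpow_mul, mul_comm]
      · rw [mul_comm, zpow_mul, zpow_natCast])
  let Ψ : Monoid.Coprod H (FreeGroup ((X × T) ⊕ X ⊕ (W → Bool))) →* H := Monoid.Coprod.lift (MonoidHom.id H) (FreeGroup.lift ψ)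
  replace hψ : ∀ e ∈ E, Ψ e = 1 := hψ
  have hc' : ∀ h, Ψ (cf h) = h := by intro h; simp [Ψ, cf]
  have hcm' : ∀ x y, Ψ (cm x y) = 1 → Ψ x * Ψ y = Ψ y * Ψ x := by
    intro x y h
    simp only [cm] at h
    rw [map_mul, map_inv, map_mul, map_mul] at h
    exact mul_inv_eq_one.1 h
  refine ⟨fun L τ => Ψ (vt L τ), fun L => Ψ (vb L), fun P => Ψ (vz P), ?_, ?_, ?_, ?_, ?_, ?_, ?_⟩
  · intro τ
    have := hψ (E1 τ) (Or.inl ⟨_, rfl⟩)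
    rw [map_mul, map_inv, mul_inv_eq_one, hc', map_list_prod, List.map_map] at this
    exact this
  · have := hψ E2 (Or.inr (Or.inl rfl))
    rw [map_mul, map_inv, mul_inv_eq_one, hc', map_list_prod, List.map_map] at this
    exact this
  · intro L L' τ τ' hne
    have := hψ (E3 (L, L', τ, τ')) (Or.inr (Or.inr (Or.inl ⟨_, rfl⟩)))
    simp only [E3] at this
    rw [if_pos hne] at this
    exact hcm' _ _ this
  · intro L L'
    have := hψ (E4 (L, L')) (Or.inr (Or.inr (Or.inr (Or.inl ⟨_, rfl⟩))))
    exact hcm' _ _ this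
  · intro L L' τ hne
    have := hψ (E5 (L, L', τ)) (Or.inr (Or.inr (Or.inr (Or.inr (Or.inl ⟨_, rfl⟩)))))
    simp only [E5] at this
    rw [if_pos hne] at this
    exact hcm' _ _ this
  · intro P τ
    have := hψ (E6 (P, τ)) (Or.inr (Or.inr (Or.inr (Or.inr (Or.inr (Or.inl ⟨_, rfl⟩))))))
    have := hcm' _ _ this
    rwa [hc'] at this
  · intro P
    have := hψ (E7 P) (Or.inr (Or.inr (Or.inr (Or.inr (Or.inr (Or.inr ⟨_, rfl⟩))))))
    simp only [E7] at this
    rw [map_mul, map_pow, map_pow, map_list_prod, List.map_map] at this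
    simp only [Function.comp_def, map_zpow] at this
    exact this

theorem commute_of_list {X H : Type} [Group H] (l : List X) (hl : l.Nodup) (β : X → H) (x : H)
    (L : X) (hL : L ∈ l) (h : ∀ L' ∈ l, L' ≠ L → Commute x (β L'))
    (hp : Commute x (l.map β).prod) : Commute x (β L) := by
  obtain ⟨l1, l2, rfl⟩ := List.append_of_mem hL
  rw [List.nodup_middle, List.nodup_cons] at hl
  have hc : ∀ l' : List X, (∀ L' ∈ l', L' ∈ l1 ++ l2) → Commute x (l'.map β).prod := by
    intro l' h'
    apply Commute.list_prod_right
    intro y hy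
    obtain ⟨L', hL', rfl⟩ := List.mem_map.1 hy
    have := h' L' hL'
    apply h L'
    · simp at this ⊢; tauto
    · rintro rfl; exact hl.1 this
  have h1 := hc l1 (by simp; tauto)
  have h2 := hc l2 (by simp; tauto)
  rw [List.map_append, List.map_cons, List.prod_append, List.prod_cons] at hp
  have := (h1.inv_right.mul_right hp).mul_right h2.inv_right
  simpa [mul_assoc] using this

theorem list_prod_central {X H : Type} [Group H] (l : List X) (β γ : X → H)
    (h : ∀ L, ∃ v ∈ Subgroup.center H, β L = γ L * v) :
    ∃ v ∈ Subgroup.center H, (l.map β).prod = (l.map γ).prod * v := by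
  induction l with
  | nil => exact ⟨1, Subgroup.one_mem _, by simp⟩
  | cons a l ih =>
    obtain ⟨v, hv, e⟩ := ih
    obtain ⟨u, hu, e'⟩ := h a
    refine ⟨u * v, Subgroup.mul_mem _ hu hv, ?_⟩
    simp only [List.map_cons, List.prod_cons, e, e']
    have := Subgroup.mem_center_iff.1 hu (l.map γ).prod
    rw [mul_assoc, mul_assoc, ← mul_assoc u, ← this, mul_assoc]

theorem exists_decomp (H : Type) [Group H] (hsvc : StronglyVerballyClosed H)
    (hfg : ∃ T : Finset H, Subgroup.closure (↑T : Set H) ⊔ Subgroup.center H = ⊤)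
    (q : ℕ) (hq : 0 < q) (b : H)
    (hb : b ^ q ∈ Subgroup.center H)
    (hnot : ∀ z ∈ Subgroup.center H, z ^ q ≠ b ^ q) (n : ℕ) (hn : 1 ≤ n) :
    ∃ K : Fin n → Subgroup H,
      (∀ i j, i ≠ j → ∀ x ∈ K i, ∀ y ∈ K j, x * y = y * x) ∧
      (⨆ i, K i) = ⊤ ∧
      ∀ i, ¬ K i ≤ Subgroup.centralizer {h : H | h ^ q = 1 ∧ h * b = b * h} := by
  classical
  obtain ⟨T, hT⟩ := hfg
  obtain ⟨X, W, _, _, ε, hε, hS⟩ := code_exists q n hq hn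
  have hlm : ∀ L, L ∈ (Finset.univ : Finset X).toList := by simp
  have hl := (Finset.univ : Finset X).nodup_toList
  generalize (Finset.univ : Finset X).toList = l at hlm hl
  obtain ⟨t, β, z, h1, h2, h3, h4, h5, h6, h7⟩ :=
    system_solution H hsvc T q b hb ε hε l hl hlm
  have hcen : ∀ x : H, (∀ τ : T, Commute x τ) → x ∈ Subgroup.center H := by
    intro x hx
    have : (⊤ : Subgroup H) ≤ Subgroup.centralizer {x} := by
      rw [← hT, sup_le_iff, Subgroup.closure_le]
      refine ⟨?_, Subgroup.center_le_centralizer _⟩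
      intro τ hτ
      rw [SetLike.mem_coe, Subgroup.mem_centralizer_singleton_iff]
      exact ((hx ⟨τ, hτ⟩).symm).eq
    rw [Subgroup.mem_center_iff]
    intro g
    exact (Subgroup.mem_centralizer_singleton_iff.1 (this (Subgroup.mem_top g)))
  have hzc : ∀ P, z P ∈ Subgroup.center H := fun P => hcen _ (h6 P)
  let K : X → Subgroup H := fun L => Subgroup.closure (Set.range (t L)) ⊔ Subgroup.center H
  have hKK : ∀ L L', L ≠ L' → K L ≤ Subgroup.centralizer (K L' : Set H) := by
    intro L L' hne
    refine sup_le ?_ (Subgroup.center_le_centralizer _)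
    rw [Subgroup.le_centralizer_iff]
    refine sup_le ?_ (Subgroup.center_le_centralizer _)
    rw [Subgroup.closure_le]
    rintro _ ⟨τ, rfl⟩
    rw [SetLike.mem_coe, Subgroup.mem_centralizer_iff]
    intro x hx
    have : Subgroup.closure (Set.range (t L)) ≤ Subgroup.centralizer {t L' τ} := by
      rw [Subgroup.closure_le]
      rintro _ ⟨τ', rfl⟩
      rw [SetLike.mem_coe, Subgroup.mem_centralizer_singleton_iff]
      exact h3 _ _ _ _ hne
    exact Subgroup.mem_centralizer_singleton_iff.1 (this hx)
  let Q : Set H := {h : H | h ^ q = 1 ∧ h * b = b * h}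
  let e : (W → Bool) → H := fun P =>
    (l.map fun L => β L ^ ε L (fun w => if P w then 1 else 0)).prod
  have heb : ∀ P, Commute (e P) b := by
    intro P
    rw [← h2]
    apply Commute.list_prod_right
    intro y hy
    obtain ⟨L, -, rfl⟩ := List.mem_map.1 hy
    apply Commute.list_prod_left
    intro y hy
    obtain ⟨L', -, rfl⟩ := List.mem_map.1 hy
    exact Commute.zpow_left (h4 L' L) _
  have hzcomm : ∀ P x, Commute (z P) x := fun P x =>
    (Subgroup.mem_center_iff.1 (hzc P) x).symm
  have heS : ∀ P, e P * z P ∈ Q := by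
    intro P
    refine ⟨?_, ?_⟩
    · rw [((hzcomm P (e P)).symm).mul_pow]; exact h7 P
    · exact ((heb P).mul_left (hzcomm P b)).eq
  have hbad : ∀ L, K L ≤ Subgroup.centralizer Q → β L ∈ Subgroup.center H := by
    intro L hK
    obtain ⟨P, hP⟩ := hS {L} (by simpa using hn)
    have hP := hP L (by simp)
    apply hcen
    intro τ
    rw [← h1 τ]
    apply Commute.list_prod_right
    intro y hy
    obtain ⟨L', -, rfl⟩ := List.mem_map.1 hy
    by_cases hLL : L' = L
    · subst hLL
      have hx : t L' τ ∈ K L' := Subgroup.mem_sup_left (Subgroup.subset_closure ⟨τ, rfl⟩)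
      have hx1 : Commute (e P * z P) (t L' τ) :=
        Subgroup.mem_centralizer_iff.1 (hK hx) _ (heS P)
      have hx2 : Commute (t L' τ) (e P) := by
        have := hx1.symm.mul_right (hzcomm P (t L' τ)).symm.inv_right
        simpa using this
      have hx3 := commute_of_list l hl
        (fun L => β L ^ ε L (fun w => if P w then 1 else 0)) (t L' τ) L' (hlm _)
        (fun M _ hM => Commute.zpow_right (h5 L' M τ hM.symm) _) hx2
      simp only [hP, zpow_one] at hx3
      exact hx3.symm
    · exact (h5 L' L τ hLL).symm
  let good : Finset X := Finset.univ.filter fun L => ¬ K L ≤ Subgroup.centralizer Q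
  have hgood : n ≤ good.card := by
    by_contra hlt
    push Not at hlt
    obtain ⟨P, hP⟩ := hS good hlt.le
    obtain ⟨v, hv, hev⟩ := list_prod_central l β
      (fun L => β L ^ ε L (fun w => if P w then 1 else 0)) (by
        intro L
        by_cases hL : K L ≤ Subgroup.centralizer Q
        · exact ⟨_, Subgroup.mul_mem _ (Subgroup.inv_mem _ (Subgroup.zpow_mem _ (hbad L hL) _))
            (hbad L hL), (mul_inv_cancel_left _ _).symm⟩
        · refine ⟨1, Subgroup.one_mem _, ?_⟩
          rw [hP L (by simp [good, hL])]; simp)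
    rw [h2] at hev
    have hev' : b = e P * v := hev
    apply hnot ((z P)⁻¹ * v) (Subgroup.mul_mem _ (Subgroup.inv_mem _ (hzc P)) hv)
    have hve : Commute (e P) v := Subgroup.mem_center_iff.1 hv _
    rw [hev', hve.mul_pow, ((hzcomm P v).inv_left).mul_pow, inv_pow]
    congr 1
    exact (eq_inv_of_mul_eq_one_left (h7 P)).symm
  obtain ⟨F, hF⟩ : ∃ F : Fin n → X, Function.Injective F ∧ ∀ i, F i ∈ good := by
    obtain ⟨s, hs, hsc⟩ := Finset.exists_subset_card_eq hgood
    exact ⟨fun i => (s.equivFinOfCardEq hsc).symm i, fun i j h => by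
      simpa using Subtype.ext h, fun i => hs ((s.equivFinOfCardEq hsc).symm i).2⟩
  obtain ⟨hFi, hFg⟩ := hF
  let i0 : Fin n := ⟨0, hn⟩
  -- assign each part to one of the `n` groups
  let r : X → Fin n := fun L => if h : ∃ i, F i = L then h.choose else i0
  have hr : ∀ i, r (F i) = i := by
    intro i
    have h : ∃ j, F j = F i := ⟨i, rfl⟩
    simp only [r]
    rw [dif_pos h]
    exact hFi h.choose_spec
  refine ⟨fun i => ⨆ L : {L // r L = i}, K L, ?_, ?_, ?_⟩
  · intro i j hij x hx y hy
    have : (⨆ L : {L // r L = i}, K L) ≤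
        Subgroup.centralizer ((⨆ L : {L // r L = j}, K L : Subgroup H) : Set H) := by
      apply iSup_le
      rintro ⟨L, hL⟩
      rw [Subgroup.le_centralizer_iff]
      apply iSup_le
      rintro ⟨L', hL'⟩
      apply hKK
      rintro rfl
      exact hij (hL.symm.trans hL')
    exact (Subgroup.mem_centralizer_iff.1 (this hx) y hy).symm
  · have hle : ∀ L, K L ≤ ⨆ i, ⨆ L : {L // r L = i}, K L := fun L =>
      le_trans (le_iSup (fun M : {M // r M = r L} => K M) ⟨L, rfl⟩)
        (le_iSup (fun i => ⨆ L : {L // r L = i}, K L) (r L))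
    rw [eq_top_iff, ← hT]
    refine sup_le ?_ (le_trans le_sup_right (hle (F i0)))
    rw [Subgroup.closure_le]
    intro τ hτ
    have := h1 ⟨τ, hτ⟩
    simp only at this
    rw [SetLike.mem_coe, ← this]
    apply Subgroup.list_prod_mem
    intro y hy
    obtain ⟨L, -, rfl⟩ := List.mem_map.1 hy
    exact hle L (Subgroup.mem_sup_left (Subgroup.subset_closure ⟨_, rfl⟩))
  · intro i hi
    have := hFg i
    simp only [good, Finset.mem_filter] at this
    exact this.2 (le_trans (le_iSup (fun M : {M // r M = i} => K M) ⟨F i, hr i⟩) hi)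

/-- Main theorem: if a strongly verbally closed group `H` is finitely generated modulo its
centre and a central element `b ^ p ^ k` is not the `p^k`-th power of any central element,
then for any `n ≥ 1` the group `H` decomposes into a product of `n` pairwise commuting
subgroups not contained in the centraliser of `{h : h ^ p ^ k = 1, [h, b] = 1}`;
in particular, this set is not contained in the centre. -/
theorem main_theorem (H : Type) [Group H] (hsvc : StronglyVerballyClosed H)
    (hfg : ∃ T : Finset H, Subgroup.closure (↑T : Set H) ⊔ Subgroup.center H = ⊤)
    (p k : ℕ) (hp : p.Prime) (hk : 1 ≤ k) (b : H)
    (hb : b ^ p ^ k ∈ Subgroup.center H)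
    (hnot : ∀ z ∈ Subgroup.center H, z ^ p ^ k ≠ b ^ p ^ k) :
    (∀ n : ℕ, 1 ≤ n → ∃ K : Fin n → Subgroup H,
      (∀ i j, i ≠ j → ∀ x ∈ K i, ∀ y ∈ K j, x * y = y * x) ∧
      (⨆ i, K i) = ⊤ ∧
      ∀ i, ¬ K i ≤ Subgroup.centralizer {h : H | h ^ p ^ k = 1 ∧ h * b = b * h}) ∧
    ¬ ({h : H | h ^ p ^ k = 1 ∧ h * b = b * h} ⊆ (Subgroup.center H : Set H)) := by
  have key := exists_decomp H hsvc hfg (p ^ k) (pow_pos hp.pos k) b hb hnot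
  refine ⟨key, fun hsub => ?_⟩
  obtain ⟨K, -, -, hK⟩ := key 1 le_rfl
  apply hK 0
  intro x _
  rw [Subgroup.mem_centralizer_iff]
  intro y hy
  exact (Subgroup.mem_center_iff.1 (hsub hy) x).symm
end

section
/- (Corollary 2) If H is a finitely generated strongly verbally closed group whose commutator subgroup is finite (equivalently, whose centre has finite index), then the centre Z(H) is a direct factor of H. -/
section CenterDirectFactor

open scoped IsMulCommutative commutatorElement

/-- The word `∏ xᵢ ^ vᵢ` in possibly non-commuting letters. -/
def wordProd {k : ℕ} {H : Type*} [Group H] (z : Fin k → H) (v : Fin k → ℤ) : H :=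
  (List.ofFn fun i => z i ^ v i).prod

lemma map_wordProd {k : ℕ} {H H' : Type*} [Group H] [Group H'] (f : H →* H') (z : Fin k → H)
    (v : Fin k → ℤ) : f (wordProd z v) = wordProd (fun i => f (z i)) v := by
  simp [wordProd, map_list_prod, List.map_ofFn, Function.comp_def]

lemma wordProd_comm {k : ℕ} {H : Type*} [CommGroup H] (z : Fin k → H) (v : Fin k → ℤ) :
    wordProd z v = ∏ i, z i ^ v i := by
  simp [wordProd, List.prod_ofFn]

lemma wordProd_commute {k : ℕ} {H : Type*} [Group H] (z : Fin k → H) (v : Fin k → ℤ) (x : H)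
    (h : ∀ i, Commute x (z i)) : Commute x (wordProd z v) := by
  apply Commute.list_prod_right
  intro y hy
  obtain ⟨i, rfl⟩ := (List.mem_ofFn' _ _).1 hy
  exact (h i).zpow_right _

lemma wordProd_exists {k : ℕ} {H : Type*} [Group H] (z : Fin k → H)
    (hz : ∀ i j, Commute (z i) (z j)) :
    ∃ (A : Subgroup H) (_ : IsMulCommutative A) (z' : Fin k → A), (∀ i, (z' i : H) = z i) ∧
      ∀ u, wordProd z u = ((∏ i, z' i ^ u i : A) : H) := by
  have hc : ∀ x ∈ Set.range z, ∀ y ∈ Set.range z, x * y = y * x := by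
    rintro _ ⟨i, rfl⟩ _ ⟨j, rfl⟩
    exact hz i j
  have hA := Subgroup.isMulCommutative_closure hc
  let z' : Fin k → Subgroup.closure (Set.range z) :=
    fun i => ⟨z i, Subgroup.subset_closure ⟨i, rfl⟩⟩
  refine ⟨Subgroup.closure (Set.range z), hA, z', fun i => rfl, fun u => ?_⟩
  rw [← wordProd_comm]
  exact (map_wordProd (Subgroup.subtype _) z' u).symm

lemma wordProd_add {k : ℕ} {H : Type*} [Group H] (z : Fin k → H)
    (hz : ∀ i j, Commute (z i) (z j)) (v w : Fin k → ℤ) :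
    wordProd z (v + w) = wordProd z v * wordProd z w := by
  obtain ⟨A, hA, z', -, key⟩ := wordProd_exists z hz
  rw [key, key, key, ← Subgroup.coe_mul, ← Finset.prod_mul_distrib]
  simp [zpow_add]

lemma wordProd_single {k : ℕ} {H : Type*} [Group H] (z : Fin k → H)
    (hz : ∀ i j, Commute (z i) (z j)) (i : Fin k) :
    wordProd z (Pi.single i 1) = z i := by
  obtain ⟨A, hA, z', hz', key⟩ := wordProd_exists z hz
  rw [key, ← hz']
  congr 1
  rw [Finset.prod_eq_single i]
  · simp
  · intro j _ hj
    simp [hj]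
  · simp

/-- A finitely generated group with finitely many commutators is finitely presented. -/
lemma finitely_presented_aux (G : Type) [Group G] [Group.FG G] [Finite (commutatorSet G)] :
    ∃ (ι : Type) (_ : Finite ι) (g : ι → G) (R : Set (FreeGroup ι)), R.Finite ∧
      (∀ r ∈ R, FreeGroup.lift g r = 1) ∧ Subgroup.closure (Set.range g) = ⊤ ∧
      ∀ (H : Type) [Group H] (h : ι → H), (∀ r ∈ R, FreeGroup.lift h r = 1) →
        ∃ ρ : G →* H, ∀ i, ρ (g i) = h i := by
  classical
  have hfi : (Subgroup.center G).FiniteIndex := inferInstance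
  have hZfg : Group.FG (Subgroup.center G) := inferInstance
  have : Module.Finite ℤ (Additive (Subgroup.center G)) :=
    Module.Finite.iff_addGroup_fg.2 inferInstance
  have := Module.finitePresentation_of_finite ℤ (Additive (Subgroup.center G))
  obtain ⟨k, m, f, g', hf, hex⟩ :=
    Module.FinitePresentation.exists_fin' ℤ (Additive (Subgroup.center G))
  let Q := G ⧸ Subgroup.center G
  have : Finite Q := inferInstance
  let s : Q → G := Quotient.out
  have hs : ∀ q : Q, (s q : Q) = q := fun q => Quotient.out_eq q
  -- the underlying element of the centre
  let F : (Fin k → ℤ) → G := fun v => ((f v).toMul : Subgroup.center G)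
  have hFcen : ∀ v x, Commute (F v) x := fun v x =>
    (Subgroup.mem_center_iff.1 ((f v).toMul : Subgroup.center G).2 x).symm
  have hFadd : ∀ v w, F (v + w) = F v * F w := by
    intro v w; simp [F]
  have hFsurj : ∀ x ∈ Subgroup.center G, ∃ v, F v = x := by
    intro x hx
    obtain ⟨v, hv⟩ := hf (Additive.ofMul ⟨x, hx⟩)
    exact ⟨v, by simp [F, hv]⟩
  let z : Fin k → G := fun i => F (Pi.single i 1)
  have hFword : ∀ v, wordProd z v = F v := by
    intro v
    have h1 : wordProd z v = ((wordProd (fun i => (f (Pi.single i 1)).toMul) v :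
      Subgroup.center G) : G) :=
      (map_wordProd (Subgroup.subtype _) (fun i => (f (Pi.single i 1)).toMul) v).symm
    rw [h1, wordProd_comm]
    simp only [F]
    congr 1
    have : f v = ∑ i, v i • f (Pi.single i 1) := by
      conv_lhs => rw [← Finset.univ_sum_single v, map_sum]
      refine Finset.sum_congr rfl fun i _ => ?_
      rw [← map_smul]
      congr 1
      ext j
      by_cases hj : j = i
      · subst hj; simp
      · simp [hj]
    rw [this, toMul_sum]
    simp
  have hFF : ∀ v w, F v = F w → ∃ u, v = w + g' u := by
    intro v w h
    have h1 : f v = f w := by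
      have : (f v).toMul = (f w).toMul := Subtype.ext h
      exact this
    have h2 : f (v - w) = 0 := by rw [map_sub, h1, sub_self]
    obtain ⟨u, hu⟩ := (hex _).1 h2
    exact ⟨u, by rw [hu]; abel⟩
  have hζ : ∀ q q' : Q, ∃ v, F v = (s (q * q'))⁻¹ * (s q * s q') := by
    intro q q'
    apply hFsurj
    rw [← QuotientGroup.eq]
    rw [hs, QuotientGroup.mk_mul, hs, hs]
  choose ζ hζ using hζ
  let g : Fin k ⊕ Q → G := Sum.elim z s
  let X : Fin k → FreeGroup (Fin k ⊕ Q) := fun i => FreeGroup.of (Sum.inl i)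
  let T : Q → FreeGroup (Fin k ⊕ Q) := fun q => FreeGroup.of (Sum.inr q)
  let R1 : Set (FreeGroup (Fin k ⊕ Q)) :=
    Set.range fun p : Fin k × (Fin k ⊕ Q) => ⁅X p.1, FreeGroup.of p.2⁆
  let R2 : Set (FreeGroup (Fin k ⊕ Q)) :=
    Set.range fun l : Fin m => wordProd X (g' (Pi.single l 1))
  let R3 : Set (FreeGroup (Fin k ⊕ Q)) :=
    Set.range fun p : Q × Q => T p.1 * T p.2 * (T (p.1 * p.2) * wordProd X (ζ p.1 p.2))⁻¹
  refine ⟨Fin k ⊕ Q, inferInstance, g, R1 ∪ R2 ∪ R3, ?_, ?_, ?_, ?_⟩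
  · exact ((Set.finite_range _).union (Set.finite_range _)).union (Set.finite_range _)
  · rintro r ((⟨p, rfl⟩ | ⟨l, rfl⟩) | ⟨p, rfl⟩)
    · simp only [X, map_commutatorElement, FreeGroup.lift_apply_of]
      exact commutatorElement_eq_one_iff_commute.2 (hFcen _ _)
    · simp only [map_wordProd, X, FreeGroup.lift_apply_of, g, Sum.elim_inl]
      rw [hFword]
      have : f (g' (Pi.single l 1)) = 0 := (hex _).2 ⟨_, rfl⟩
      simp [F, this]
    · simp only [map_mul, map_inv, map_wordProd, X, T, FreeGroup.lift_apply_of, g, Sum.elim_inl,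
        Sum.elim_inr]
      rw [hFword, hζ]
      group
  · rw [eq_top_iff]
    rintro x -
    obtain ⟨v, hv⟩ := hFsurj ((s (x : Q))⁻¹ * x) (by
      rw [← QuotientGroup.eq, hs])
    have hx : x = s (x : Q) * wordProd z v := by rw [hFword, hv]; group
    rw [hx]
    refine Subgroup.mul_mem _ (Subgroup.subset_closure ⟨Sum.inr _, rfl⟩) ?_
    refine Subgroup.list_prod_mem _ ?_
    intro y hy
    obtain ⟨i, rfl⟩ := (List.mem_ofFn' _ _).1 hy
    exact Subgroup.zpow_mem _ (Subgroup.subset_closure (Set.mem_range_self (f := g) (Sum.inl i))) _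
  · intro H _ h hR
    let zz : Fin k → H := fun i => h (Sum.inl i)
    let t : Q → H := fun q => h (Sum.inr q)
    have hz1 : ∀ i j, Commute (zz i) (h j) := by
      intro i j
      have := hR _ (Or.inl (Or.inl ⟨(i, j), rfl⟩))
      simp only [X, map_commutatorElement, FreeGroup.lift_apply_of] at this
      exact commutatorElement_eq_one_iff_commute.1 this
    have hzz : ∀ i j, Commute (zz i) (zz j) := fun i j => hz1 i _
    have hzt : ∀ v q, Commute (t q) (wordProd zz v) := fun v q =>
      wordProd_commute _ _ _ fun i => (hz1 i _).symm
    have hker : ∀ u, wordProd zz (g' u) = 1 := by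
      intro u
      let S : AddSubgroup (Fin m → ℤ) :=
        { carrier := {u | wordProd zz (g' u) = 1}
          zero_mem' := by simp [wordProd]
          add_mem' := by
            intro a b ha hb
            simp only [Set.mem_ofPred_eq] at ha hb ⊢
            rw [map_add, wordProd_add _ hzz, ha, hb, one_mul]
          neg_mem' := by
            intro a ha
            simp only [Set.mem_ofPred_eq] at ha ⊢
            have h1 := wordProd_add zz hzz (g' a) (g' (-a))
            rw [← map_add, add_neg_cancel, ha, one_mul] at h1
            rw [← h1]
            simp [wordProd] }
      have hu : u = ∑ l, u l • (Pi.single l 1 : Fin m → ℤ) := by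
        conv_lhs => rw [← Finset.univ_sum_single u]
        refine Finset.sum_congr rfl fun i _ => ?_
        ext j
        by_cases hj : j = i
        · subst hj; simp
        · simp [hj]
      have : u ∈ S := by
        rw [hu]
        refine AddSubgroup.sum_mem _ fun l _ => AddSubgroup.zsmul_mem _ ?_ _
        have := hR _ (Or.inl (Or.inr ⟨l, rfl⟩))
        simp only [map_wordProd, X, FreeGroup.lift_apply_of] at this
        exact this
      exact this
    have hWF : ∀ v w, F v = F w → wordProd zz v = wordProd zz w := by
      intro v w hvw
      obtain ⟨u, rfl⟩ := hFF v w hvw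
      rw [wordProd_add _ hzz, hker, mul_one]
    have hcoc : ∀ q q', t q * t q' = t (q * q') * wordProd zz (ζ q q') := by
      intro q q'
      have := hR _ (Or.inr ⟨(q, q'), rfl⟩)
      simp only [map_mul, map_inv, map_wordProd, X, T, FreeGroup.lift_apply_of] at this
      exact mul_inv_eq_one.1 this
    have hdec : ∀ x : G, ∃ v, F v = (s (x : Q))⁻¹ * x := fun x => hFsurj _ (by
      rw [← QuotientGroup.eq, hs])
    choose d hd using hdec
    have hmul : ∀ x y, t ((x * y : G) : Q) * wordProd zz (d (x * y)) =
        (t x * wordProd zz (d x)) * (t y * wordProd zz (d y)) := by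
      intro x y
      have e1 : F (d (x * y)) = F (ζ x y + d x + d y) := by
        rw [hFadd, hFadd, hd, hζ, hd y, hd x, ← QuotientGroup.mk_mul]
        have := hFcen (d x) (s (y : Q))
        rw [hd, commute_iff_eq] at this
        calc (s ((x * y : G) : Q))⁻¹ * (x * y)
            = (s ((x * y : G) : Q))⁻¹ * (s (x : Q) * (((s (x : Q))⁻¹ * x) * s (y : Q)) *
              ((s (y : Q))⁻¹ * y)) := by group
          _ = _ := by rw [this]; group
      rw [hWF _ _ e1, wordProd_add _ hzz, wordProd_add _ hzz]
      have c := (hzt (d x) (y : Q)).eq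
      calc _ = (t ((x : Q) * (y : Q)) * wordProd zz (ζ x y)) * wordProd zz (d x)
                * wordProd zz (d y) := by simp only [mul_assoc]; rfl
        _ = t x * (t y * wordProd zz (d x)) * wordProd zz (d y) := by
            rw [← hcoc]; simp only [mul_assoc]
        _ = _ := by rw [c]; simp only [mul_assoc]
    let ρ : G →* H := MonoidHom.mk' (fun x => t x * wordProd zz (d x)) hmul
    have hρs : ∀ q, ρ (s q) = t q := by
      intro q
      have : F (d (s q)) = F 0 := by
        rw [hd, hs]; simp [F]
      change t (s q : Q) * wordProd zz (d (s q)) = t q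
      rw [hWF _ _ this, hs]
      simp [wordProd]
    refine ⟨ρ, ?_⟩
    rintro (i | q)
    · -- value on a central generator
      have e : ρ (s 1 * z i) = t 1 * zz i := by
        have hq : ((s 1 * z i : G) : Q) = 1 := by
          rw [QuotientGroup.mk_mul, hs, one_mul]
          exact (QuotientGroup.eq_one_iff _).2 ((f (Pi.single i 1)).toMul : Subgroup.center G).2
        have : F (d (s 1 * z i)) = F (Pi.single i 1) := by
          rw [hd, hq]; simp [z]
        change t ((s 1 * z i : G) : Q) * wordProd zz (d (s 1 * z i)) = _
        rw [hWF _ _ this, hq]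
        rw [wordProd_single zz hzz]
      rw [map_mul, hρs] at e
      exact mul_left_cancel e
    · exact hρs q

/-- If `H` is algebraically closed in `G`, it is a retract of every finitely generated
intermediate group with finitely many commutators. -/
lemma exists_retraction_aux {H G G0 : Type} [Group H] [Group G] [Group G0] (hfg : Group.FG H)
    (f : H →* G) (hac : AlgebraicallyClosedHom f) [Group.FG G0] [Finite (commutatorSet G0)]
    (i : H →* G0) (p : G0 →* G) (hpi : ∀ h, p (i h) = f h) :
    ∃ q : G0 →* H, ∀ h, q (i h) = h := by
  classical
  obtain ⟨ι, hι, g, R, hRfin, hR, hgen, hext⟩ := finitely_presented_aux G0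
  obtain ⟨e, he⟩ := exists_injective_nat ι
  have hlift : ∀ {K : Type} [Group K] (φ : ℕ → K) (w : FreeGroup ι),
      FreeGroup.lift φ (FreeGroup.map e w) = FreeGroup.lift (fun j => φ (e j)) w := by
    intro K _ φ w
    have : (FreeGroup.lift φ).comp (FreeGroup.map e) = FreeGroup.lift (fun j => φ (e j)) := by
      ext j; simp
    exact DFunLike.congr_fun this w
  have hword : ∀ x : G0, ∃ w : FreeGroup ι, FreeGroup.lift g w = x := by
    intro x
    have : x ∈ (FreeGroup.lift g).range := by
      rw [FreeGroup.range_lift_eq_closure, hgen]; trivial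
    exact this
  choose W hW using hword
  obtain ⟨S, hS, hSfin⟩ := Group.fg_iff.1 hfg
  let E : Set (Monoid.Coprod H (FreeGroup ℕ)) :=
    (fun r => Monoid.Coprod.inr (FreeGroup.map e r)) '' R ∪
    (fun s => (Monoid.Coprod.inl s)⁻¹ * Monoid.Coprod.inr (FreeGroup.map e (W (i s)))) '' S
  have hE : E.Finite := (hRfin.image _).union (hSfin.image _)
  obtain ⟨ψ, hψ⟩ := hac hE.toFinset.card (fun j => (hE.toFinset.equivFin.symm j : _)) (by
    refine ⟨Function.extend e (fun j => p (g j)) 1, fun j => ?_⟩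
    have hj : ((hE.toFinset.equivFin.symm j : _) : Monoid.Coprod H (FreeGroup ℕ)) ∈ E :=
      hE.mem_toFinset.1 (hE.toFinset.equivFin.symm j).2
    generalize ((hE.toFinset.equivFin.symm j : _) : Monoid.Coprod H (FreeGroup ℕ)) = y at hj
    have hp : ∀ w, FreeGroup.lift (fun j => p (g j)) w = p (FreeGroup.lift g w) := by
      intro w
      have : FreeGroup.lift (fun j => p (g j)) = p.comp (FreeGroup.lift g) := by
        ext j; simp
      exact DFunLike.congr_fun this w
    rcases hj with ⟨r, hr, rfl⟩ | ⟨s, hs, rfl⟩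
    · simp only [Monoid.Coprod.lift_apply_inr, hlift, he.extend_apply]
      rw [hp, hR r hr, map_one]
    · simp only [map_mul, map_inv, Monoid.Coprod.lift_apply_inl, Monoid.Coprod.lift_apply_inr,
        hlift, he.extend_apply]
      rw [hp, hW, hpi, inv_mul_cancel])
  have hψ' : ∀ y ∈ E, Monoid.Coprod.lift (MonoidHom.id H) (FreeGroup.lift ψ) y = 1 := by
    intro y hy
    have := hψ (hE.toFinset.equivFin ⟨y, hE.mem_toFinset.2 hy⟩)
    simpa only [Equiv.symm_apply_apply] using this
  obtain ⟨q, hq⟩ := hext H (fun j => ψ (e j)) (by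
    intro r hr
    have := hψ' _ (Or.inl ⟨r, hr, rfl⟩)
    simpa only [Monoid.Coprod.lift_apply_inr, hlift] using this)
  refine ⟨q, ?_⟩
  have hqw : ∀ w, FreeGroup.lift (fun j => ψ (e j)) w = q (FreeGroup.lift g w) := by
    intro w
    have : FreeGroup.lift (fun j => ψ (e j)) = q.comp (FreeGroup.lift g) := by
      ext j; simp [hq]
    exact DFunLike.congr_fun this w
  have : q.comp i = MonoidHom.id H := by
    refine MonoidHom.eq_of_eqOn_dense hS ?_
    intro s hs
    have := hψ' _ (Or.inr ⟨s, hs, rfl⟩)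
    simp only [map_mul, map_inv, Monoid.Coprod.lift_apply_inl, Monoid.Coprod.lift_apply_inr,
        hlift, hqw, hW, MonoidHom.id_apply] at this
    exact (inv_mul_eq_one.1 this).symm
  exact fun h => DFunLike.congr_fun this h

lemma orthogonal_core {A P : Type*} [AddCommGroup A] [Fintype P] (e : P → A →+ A)
    (Y : AddSubgroup A) (hY : ∀ K, ∀ y ∈ Y, e K y ∈ Y) (z : A) (hsum : ∑ K, e K z = z)
    (horth : ∀ K L, K ≠ L → e K (e L z) ∈ Y) (a b : P → ℤ)
    (ha : ∑ K, a K • e K z ∈ Y) (hb : ∑ K, b K • e K z ∈ Y)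
    (hcop : ∀ K, IsCoprime (a K) (b K)) : z ∈ Y := by
  classical
  have h1 : ∀ (c : P → ℤ) K, (∑ L, c L • e L z ∈ Y) → c K • e K (e K z) ∈ Y := by
    intro c K hc
    have h2 := hY K _ hc
    rw [map_sum, ← Finset.add_sum_erase _ _ (Finset.mem_univ K)] at h2
    rw [map_zsmul] at h2
    refine (AddSubgroup.add_mem_cancel_right Y ?_).1 h2
    refine AddSubgroup.sum_mem _ fun L hL => ?_
    rw [map_zsmul]
    exact AddSubgroup.zsmul_mem _ (horth _ _ (Finset.ne_of_mem_erase hL).symm) _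
  have h3 : ∀ K, e K (e K z) ∈ Y := by
    intro K
    obtain ⟨u, v, huv⟩ := hcop K
    have : e K (e K z) = u • (a K • e K (e K z)) + v • (b K • e K (e K z)) := by
      rw [smul_smul, smul_smul, ← add_smul, huv, one_smul]
    rw [this]
    exact AddSubgroup.add_mem _ (AddSubgroup.zsmul_mem _ (h1 a K ha) _)
      (AddSubgroup.zsmul_mem _ (h1 b K hb) _)
  have h4 : ∀ K, e K z ∈ Y := by
    intro K
    rw [← hsum, map_sum]
    refine AddSubgroup.sum_mem _ fun L _ => ?_
    by_cases h : K = L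
    · subst h; exact h3 K
    · exact horth _ _ h
  rw [← hsum]
  exact AddSubgroup.sum_mem _ fun L _ => h4 L

lemma core_alg {H P : Type} [Group H] [Finite P]
    (Q : (P → H) × (Multiplicative ℤ × Multiplicative ℤ) →* H)
    (hQ : ∀ h, Q (fun _ => h, 1) = h) (a b : P → ℤ) (hcop : ∀ K, IsCoprime (a K) (b K))
    (z x c : H) (hz : z ∈ Subgroup.center H) (hc : c ∈ commutator H) (n : ℕ)
    (hzx : z = x ^ n * c)
    (h1 : Q (fun K => z ^ a K, (Multiplicative.ofAdd (n : ℤ), 1)) = 1)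
    (h2 : Q (fun K => z ^ b K, (1, Multiplicative.ofAdd (n : ℤ))) = 1) :
    ∃ y ∈ Subgroup.center H, y ^ n = z := by
  classical
  have := Fintype.ofFinite P
  have hQc : ∀ k, (∀ k', Commute k k') → Q k ∈ Subgroup.center H := by
    intro k hk
    rw [Subgroup.mem_center_iff]
    intro h
    have := (hk (fun _ => h, 1)).map Q
    rw [hQ] at this
    exact this.eq.symm
  let Z := Subgroup.center H
  let ρ : P → H →* H := fun K =>
    Q.comp ((MonoidHom.inl _ _).comp (MonoidHom.mulSingle (fun _ => H) K))
  have hρ : ∀ K h, ρ K h = Q (Pi.mulSingle K h, 1) := fun K h => rfl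
  let σ : P → H → H := fun K h => Q (Function.update (fun _ => h) K 1, 1)
  have hdec : ∀ K h, h = ρ K h * σ K h := by
    intro K h
    rw [hρ]
    simp only [σ]
    rw [← map_mul]
    conv_lhs => rw [← hQ h]
    congr 1
    ext L
    · by_cases hL : L = K
      · subst hL; simp
      · simp [hL]
    · simp
    · simp
  have hcommσ : ∀ K h h', Commute (ρ K h) (σ K h') := by
    intro K h h'
    refine Commute.map (f := Q) (x := (Pi.mulSingle K h, 1))
      (y := (Function.update (fun _ => h') K 1, 1)) ?_
    refine Prod.commute_iff.2 ⟨?_, Commute.one_right _⟩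
    refine Pi.commute_iff.2 fun L => ?_
    by_cases hL : L = K
    · subst hL; simp
    · simp [hL]
  have hcommρ : ∀ K L h h', K ≠ L → Commute (ρ K h) (ρ L h') := by
    intro K L h h' hKL
    refine Commute.map (f := Q) (x := (Pi.mulSingle K h, 1)) (y := (Pi.mulSingle L h', 1)) ?_
    refine Prod.commute_iff.2 ⟨?_, Commute.one_right _⟩
    exact Pi.mulSingle_commute hKL _ _
  have hZZ : ∀ K L h, K ≠ L → ρ K (ρ L h) ∈ Z := by
    intro K L h hKL
    rw [Subgroup.mem_center_iff]
    intro h'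
    have e1 : Commute (ρ K h') (ρ K (ρ L h)) := by
      have : ρ K (ρ L h) = ρ L h * (σ K (ρ L h))⁻¹ :=
        eq_mul_inv_of_mul_eq (hdec K (ρ L h)).symm
      rw [this]
      exact (hcommρ K L _ _ hKL).mul_right (hcommσ K _ _).inv_right
    have e2 : Commute (σ K h') (ρ K (ρ L h)) := (hcommσ K _ _).symm
    have e3 := e1.mul_left e2
    rw [← hdec] at e3
    exact e3.eq
  let QZ : (P → Z) × (Multiplicative ℤ × Multiplicative ℤ) →* Z :=
    (Q.comp (MonoidHom.prodMap (MonoidHom.pi fun K => Z.subtype.comp (Pi.evalMonoidHom _ K))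
      (MonoidHom.id _))).codRestrict Z (by
      intro k
      apply hQc
      intro k'
      refine Prod.commute_iff.2 ⟨?_, Commute.all _ _⟩
      exact Pi.commute_iff.2 fun L => (Subgroup.mem_center_iff.1 (k.1 L).2 _).symm)
  have hQZ : ∀ u v, ((QZ (u, v) : Z) : H) = Q (fun K => (u K : H), v) := fun u v => rfl
  let e : P → Z →* Z := fun K =>
    QZ.comp ((MonoidHom.inl _ _).comp (MonoidHom.mulSingle (fun _ => Z) K))
  have he : ∀ K (y : Z), ((e K y : Z) : H) = ρ K y := by
    intro K y
    rw [hρ]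
    change Q (fun L => ((Pi.mulSingle K y : P → Z) L : H), 1) = _
    congr 2
    ext L
    by_cases hL : L = K
    · subst hL; simp
    · simp [hL]
  have hprod : ∀ u : P → Z, QZ (u, 1) = ∏ K, e K (u K) := by
    intro u
    have : QZ.comp (MonoidHom.inl _ _) u = ∏ K, e K (u K) := by
      conv_lhs => rw [← Finset.univ_prod_mulSingle u, map_prod]
      rfl
    exact this
  let ζ : Z := ⟨z, hz⟩
  let Y : Subgroup Z := (powMonoidHom n : Z →* Z).range
  have hrel : ∀ (c : P → ℤ) (v : Multiplicative ℤ × Multiplicative ℤ),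
      Q (fun K => z ^ c K, v ^ n) = 1 → ∏ K, e K ζ ^ c K ∈ Y := by
    intro c v hcv
    have e1 : QZ (fun K => ζ ^ c K, v ^ n) = 1 := by
      apply Subtype.ext
      rw [hQZ]
      exact hcv
    have e2 : ((fun K => ζ ^ c K, v ^ n) : (P → Z) × (Multiplicative ℤ × Multiplicative ℤ)) =
        (fun K => ζ ^ c K, 1) * (1, v) ^ n := by
      ext <;> simp
    rw [e2, map_mul, map_pow, hprod] at e1
    simp only [map_zpow] at e1
    rw [eq_inv_of_mul_eq_one_left e1]
    exact Subgroup.inv_mem _ ⟨_, rfl⟩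
  have key : Additive.ofMul ζ ∈ Subgroup.toAddSubgroup Y := by
    refine orthogonal_core (fun K => MonoidHom.toAdditive (e K)) (Subgroup.toAddSubgroup Y)
      ?_ _ ?_ ?_ a b ?_ ?_ hcop
    · rintro K y ⟨w, rfl⟩
      exact ⟨e K w, (map_pow (e K) w n).symm⟩
    · have := hprod (fun _ => ζ)
      have e1 : QZ (fun _ => ζ, 1) = ζ := by
        apply Subtype.ext
        rw [hQZ]
        exact hQ z
      rw [e1] at this
      exact congrArg Additive.ofMul this.symm
    · intro K L hKL
      let τ : H →* Z := ((ρ K).comp (ρ L)).codRestrict Z (fun h => hZZ K L h hKL)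
      have hτc : τ c = 1 := by
        have : commutator H ≤ τ.ker := Abelianization.commutator_subset_ker τ
        exact this hc
      have hτ : τ z = τ x ^ n := by
        rw [hzx, map_mul, map_pow, hτc, mul_one]
      have : e K (e L ζ) = τ z := by
        apply Subtype.ext
        rw [he, he]
        rfl
      change e K (e L ζ) ∈ Y
      rw [this, hτ]
      exact ⟨_, rfl⟩
    · exact hrel a (Multiplicative.ofAdd 1, 1) (by
        rw [← h1]; congr 3
        simp [← ofAdd_nsmul])
    · exact hrel b (1, Multiplicative.ofAdd 1) (by
        rw [← h2]; congr 3
        simp [← ofAdd_nsmul])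
  obtain ⟨y, hy⟩ : ζ ∈ Y := key
  exact ⟨y, y.2, congrArg Subtype.val hy⟩

/-- Purity of the centre (and more): a central `n`-th power modulo the commutator subgroup is an
`n`-th power in the centre. -/
lemma center_pure {H : Type} [Group H] (hfg : Group.FG H)
    (hsvc : StronglyVerballyClosed H) (hcomm : Finite (commutator H)) (n : ℕ) (hn : n ≠ 0)
    (z x c : H) (hz : z ∈ Subgroup.center H) (hc : c ∈ commutator H) (hzx : z = x ^ n * c) :
    ∃ y ∈ Subgroup.center H, y ^ n = z := by
  classical
  have : NeZero n := ⟨hn⟩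
  have hzc : ∀ (k : ℤ) (h : H), Commute (z ^ k) h := fun k h =>
    Commute.zpow_left (Subgroup.mem_center_iff.1 hz h).symm k
  let N := {p : ℤ × ℤ // IsCoprime p.1 p.2}
  let τ : Multiplicative (ℤ × ℤ) →* (N → H) :=
    MonoidHom.mk' (fun v i => z ^ (i.1.1 * v.toAdd.1 + i.1.2 * v.toAdd.2)) (by
      intro v w
      ext i
      simp only [Pi.mul_apply, ← zpow_add]
      congr 1
      simp
      ring)
  have hτ : ∀ v i, τ v i = z ^ (i.1.1 * v.toAdd.1 + i.1.2 * v.toAdd.2) := fun v i => rfl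
  have hnorm : τ.range.Normal := by
    constructor
    rintro _ ⟨v, rfl⟩ g
    refine ⟨v, ?_⟩
    ext i
    simp only [Pi.mul_apply, Pi.inv_apply]
    rw [hτ, ← (hzc _ _).eq, mul_inv_cancel_right]
  have hcoord : ∀ k ∈ τ.range, ∃ i, k i = 1 := by
    rintro _ ⟨v, rfl⟩
    obtain ⟨p, hp, hpv⟩ : ∃ p : ℤ × ℤ, IsCoprime p.1 p.2 ∧
        p.1 * v.toAdd.1 + p.2 * v.toAdd.2 = 0 := by
      generalize v.toAdd = u
      by_cases hu : Int.gcd u.1 u.2 = 0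
      · rw [Int.gcd_eq_zero_iff] at hu
        exact ⟨(1, 0), isCoprime_one_left, by simp [hu.1]⟩
      · obtain ⟨a, b, hab, ha, hb⟩ := Int.exists_gcd_one (Nat.pos_of_ne_zero hu)
        refine ⟨(b, -a), ?_, ?_⟩
        · exact (Int.isCoprime_iff_gcd_eq_one.2 hab).symm.neg_right
        · simp only
          generalize (Int.gcd u.1 u.2 : ℤ) = d at *
          rw [ha, hb]; ring
    exact ⟨⟨p, hp⟩, by rw [hτ, hpv, zpow_zero]⟩
  let G := (N → H) ⧸ τ.range
  let mk : (N → H) →* G := QuotientGroup.mk' τ.range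
  let f : H →* G := mk.comp (Pi.constMonoidHom N H)
  have hinj : Function.Injective f := by
    rw [injective_iff_map_eq_one]
    intro h hh
    obtain ⟨i, hi⟩ := hcoord _ ((QuotientGroup.eq_one_iff _).1 hh)
    exact hi
  have hvc : VerballyClosedHom f := by
    rintro w h ⟨φ, hφ⟩
    choose φ' hφ' using fun k => QuotientGroup.mk'_surjective τ.range (φ k)
    have e1 : FreeGroup.lift φ w = mk (FreeGroup.lift φ' w) := by
      have : FreeGroup.lift φ = mk.comp (FreeGroup.lift φ') := by
        ext k
        rw [FreeGroup.lift_apply_of, ← hφ']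
        simp only [MonoidHom.comp_apply, FreeGroup.lift_apply_of]
        rfl
      exact DFunLike.congr_fun this w
    rw [e1] at hφ
    obtain ⟨i, hi⟩ := hcoord _ (QuotientGroup.eq.1 hφ)
    refine ⟨fun k => φ' k i, ?_⟩
    have e2 : FreeGroup.lift (fun k => φ' k i) w = FreeGroup.lift φ' w i := by
      have : FreeGroup.lift (fun k => φ' k i) =
          (Pi.evalMonoidHom (fun _ => H) i).comp (FreeGroup.lift φ') := by
        ext k; simp
      exact DFunLike.congr_fun this w
    rw [e2]
    exact inv_mul_eq_one.1 hi
  have hac := hsvc G f hinj hvc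
  -- the finitely generated intermediate group
  let red : N → ZMod n × ZMod n := fun i => (i.1.1, i.1.2)
  let P := Set.range red
  have : Finite P := inferInstance
  let κ : N → P := fun i => ⟨red i, i, rfl⟩
  choose rep hrep using fun K : P => K.2
  have hd : ∀ i : N, ∃ δ : ℤ × ℤ, i.1.1 = (rep (κ i)).1.1 + n * δ.1 ∧
      i.1.2 = (rep (κ i)).1.2 + n * δ.2 := by
    intro i
    have e := hrep (κ i)
    have e1 : (((rep (κ i)).1.1 : ℤ) : ZMod n) = ((i.1.1 : ℤ) : ZMod n) := congrArg Prod.fst e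
    have e2 : (((rep (κ i)).1.2 : ℤ) : ZMod n) = ((i.1.2 : ℤ) : ZMod n) := congrArg Prod.snd e
    obtain ⟨d1, h1⟩ := (ZMod.intCast_eq_intCast_iff_dvd_sub _ _ _).1 e1
    obtain ⟨d2, h2⟩ := (ZMod.intCast_eq_intCast_iff_dvd_sub _ _ _).1 e2
    exact ⟨(d1, d2), by simp only; linarith, by simp only; linarith⟩
  choose δ hδ1 hδ2 using hd
  let M := (P → H) × (Multiplicative ℤ × Multiplicative ℤ)
  let Θ0 : M →* (N → H) :=
    MonoidHom.mk' (fun u i => u.1 (κ i) *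
      z ^ ((δ i).1 * u.2.1.toAdd + (δ i).2 * u.2.2.toAdd)) (by
      intro u v
      ext i
      change (u.1 (κ i) * v.1 (κ i)) * z ^ ((δ i).1 * (u.2.1.toAdd + v.2.1.toAdd) +
        (δ i).2 * (u.2.2.toAdd + v.2.2.toAdd)) = (u.1 (κ i) * z ^ ((δ i).1 * u.2.1.toAdd +
        (δ i).2 * u.2.2.toAdd)) * (v.1 (κ i) * z ^ ((δ i).1 * v.2.1.toAdd +
        (δ i).2 * v.2.2.toAdd))
      have e : (δ i).1 * (u.2.1.toAdd + v.2.1.toAdd) + (δ i).2 * (u.2.2.toAdd + v.2.2.toAdd) =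
        ((δ i).1 * u.2.1.toAdd + (δ i).2 * u.2.2.toAdd) +
        ((δ i).1 * v.2.1.toAdd + (δ i).2 * v.2.2.toAdd) := by ring
      rw [e, zpow_add]
      have c := (hzc ((δ i).1 * u.2.1.toAdd + (δ i).2 * u.2.2.toAdd) (v.1 (κ i))).eq
      calc _ = u.1 (κ i) * (v.1 (κ i) * z ^ ((δ i).1 * u.2.1.toAdd + (δ i).2 * u.2.2.toAdd)) *
            z ^ ((δ i).1 * v.2.1.toAdd + (δ i).2 * v.2.2.toAdd) := by simp only [mul_assoc]
        _ = _ := by rw [← c]; simp only [mul_assoc])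
  have hΘ0 : ∀ u i, Θ0 u i = u.1 (κ i) *
      z ^ ((δ i).1 * u.2.1.toAdd + (δ i).2 * u.2.2.toAdd) := fun u i => rfl
  let Θ : M →* G := mk.comp Θ0
  have hMfg : Group.FG M := by
    have : Group.FG (Multiplicative ℤ) := inferInstance
    infer_instance
  have hfin : Finite (commutatorSet Θ.range) := by
    let S : Set M := {u | (∀ K, u.1 K ∈ (commutator H : Set H)) ∧ u.2 = 1}
    have hS : S.Finite := by
      have h1 : (Set.pi Set.univ fun _ : P => (commutator H : Set H)).Finite :=
        Set.Finite.pi fun _ => Set.toFinite _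
      refine (h1.prod (Set.finite_singleton (1 : Multiplicative ℤ × Multiplicative ℤ))).subset ?_
      rintro u ⟨hu1, hu2⟩
      exact ⟨fun K _ => hu1 K, hu2⟩
    refine (Set.Finite.subset (hS.image Θ.rangeRestrict) ?_).to_subtype
    rintro _ ⟨x, y, rfl⟩
    obtain ⟨u, rfl⟩ := Θ.rangeRestrict_surjective x
    obtain ⟨v, rfl⟩ := Θ.rangeRestrict_surjective y
    refine ⟨⁅u, v⁆, ⟨fun K => ?_, ?_⟩, map_commutatorElement _ _ _⟩
    · exact Subgroup.commutator_mem_commutator (Subgroup.mem_top (u.1 K)) (Subgroup.mem_top (v.1 K))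
    · exact commutatorElement_eq_one_iff_commute.2 (Commute.all u.2 v.2)
  let ι : H →* M := (MonoidHom.inl _ _).comp (Pi.constMonoidHom P H)
  obtain ⟨q, hq⟩ := exists_retraction_aux hfg f hac (Θ.rangeRestrict.comp ι) Θ.range.subtype (by
    intro h
    change mk (Θ0 (ι h)) = mk _
    congr 1
    ext i
    rw [hΘ0]
    simp [ι])
  have hkill : ∀ u v, Θ0 u = τ v → q (Θ.rangeRestrict u) = 1 := by
    intro u v h
    have : Θ.rangeRestrict u = 1 := by
      apply Subtype.ext
      exact (QuotientGroup.eq_one_iff _).2 ⟨v, h.symm⟩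
    rw [this, map_one]
  refine core_alg (q.comp Θ.rangeRestrict) (fun h => hq h) (fun K => (rep K).1.1)
    (fun K => (rep K).1.2) (fun K => (rep K).2) z x c hz hc n hzx ?_ ?_
  · apply hkill _ (Multiplicative.ofAdd (1, 0))
    ext i
    rw [hΘ0, hτ]
    simp only [← zpow_add]
    congr 1
    simp
    rw [hδ1 i]
    ring
  · apply hkill _ (Multiplicative.ofAdd (0, 1))
    ext i
    rw [hΘ0, hτ]
    simp only [← zpow_add]
    congr 1
    simp
    rw [hδ2 i]
    ring

/-- A pure subgroup of a finitely generated abelian group is a retract. -/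
lemma exists_retraction_of_pure {A : Type} [AddCommGroup A] [AddGroup.FG A] (S : AddSubgroup A)
    (hS : ∀ (n : ℕ) (a : A), n ≠ 0 → n • a ∈ S → ∃ s ∈ S, n • s = n • a) :
    ∃ r : A →+ A, (∀ a, r a ∈ S) ∧ ∀ s ∈ S, r s = s := by
  classical
  have : AddGroup.FG (A ⧸ S) := inferInstance
  obtain ⟨n, ι, _, p, hp, e, ⟨E⟩⟩ := AddCommGroup.equiv_free_prod_directSum_zmod (A ⧸ S)
  have hsurj : ∀ y : (Fin n →₀ ℤ) × (DirectSum ι fun i => ZMod (p i ^ e i)),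
      ∃ a : A, E (a : A ⧸ S) = y := by
    intro y
    obtain ⟨a, ha⟩ := QuotientAddGroup.mk_surjective (E.symm y)
    exact ⟨a, by rw [ha]; simp⟩
  choose a ha using fun j : Fin n => hsurj (Finsupp.single j 1, 0)
  have hb : ∀ i : ι, ∃ b : A, E (b : A ⧸ S) = (0, DirectSum.of (fun i => ZMod (p i ^ e i)) i 1) ∧
      (p i ^ e i) • b = 0 := by
    intro i
    obtain ⟨b, hb⟩ := hsurj (0, DirectSum.of (fun i => ZMod (p i ^ e i)) i 1)
    have h0 : (p i ^ e i) • b ∈ S := by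
      rw [← QuotientAddGroup.eq_zero_iff]
      apply E.injective
      rw [QuotientAddGroup.mk_nsmul, map_nsmul, hb, map_zero]
      ext1
      · simp
      · simp only [Prod.smul_snd, Prod.snd_zero]
        rw [← map_nsmul]
        simp
    obtain ⟨s, hs, hsb⟩ := hS _ _ (pow_ne_zero _ (hp i).ne_zero) h0
    refine ⟨b - s, ?_, by rw [nsmul_sub, hsb, sub_self]⟩
    rw [← hb]
    congr 1
    rw [QuotientAddGroup.mk_sub, (QuotientAddGroup.eq_zero_iff s).2 hs, sub_zero]
  choose b hb hb0 using hb
  let t1 : (Fin n →₀ ℤ) →+ A := Finsupp.liftAddHom fun j => (zmultiplesHom A (a j))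
  let t2 : (DirectSum ι fun i => ZMod (p i ^ e i)) →+ A :=
    DirectSum.toAddMonoid fun i => ZMod.lift (p i ^ e i) ⟨zmultiplesHom A (b i), by
      rw [zmultiplesHom_apply, natCast_zsmul]
      exact hb0 i⟩
  let t : (Fin n →₀ ℤ) × (DirectSum ι fun i => ZMod (p i ^ e i)) →+ A := t1.coprod t2
  let π : A →+ (Fin n →₀ ℤ) × (DirectSum ι fun i => ZMod (p i ^ e i)) :=
    E.toAddMonoidHom.comp (QuotientAddGroup.mk' S)
  have hπ : ∀ x, π x = E (x : A ⧸ S) := fun x => rfl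
  have ht : π.comp t = AddMonoidHom.id _ := by
    have k1 : ∀ u, π (t1 u) = (u, 0) := by
      intro u
      have : π.comp t1 = AddMonoidHom.inl _ _ := by
        apply Finsupp.addHom_ext'
        intro j
        apply AddMonoidHom.ext_int
        simp [t1, hπ, ha]
      exact DFunLike.congr_fun this u
    have k2 : ∀ v, π (t2 v) = (0, v) := by
      intro v
      have : π.comp t2 = AddMonoidHom.inr _ _ := by
        apply DirectSum.addHom_ext
        intro i y
        obtain ⟨m, rfl⟩ := ZMod.intCast_surjective y
        simp only [t2, AddMonoidHom.comp_apply, DirectSum.toAddMonoid_of, ZMod.lift_coe,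
          zmultiplesHom_apply, AddMonoidHom.inr_apply]
        rw [map_zsmul, hπ, hb]
        ext1
        · simp
        · simp only [Prod.smul_snd]
          rw [← map_zsmul]
          simp
      exact DFunLike.congr_fun this v
    apply AddMonoidHom.ext
    rintro ⟨u, v⟩
    simp [t, k1, k2]
  have ht' : ∀ y, π (t y) = y := fun y => DFunLike.congr_fun ht y
  refine ⟨AddMonoidHom.id A - t.comp π, ?_, ?_⟩
  · intro x
    rw [← QuotientAddGroup.eq_zero_iff]
    apply E.injective
    rw [← hπ]
    simp [ht']
  · intro s hs
    have : π s = 0 := by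
      rw [hπ, (QuotientAddGroup.eq_zero_iff s).2 hs, map_zero]
    simp [this]

lemma torsion_bound (A : Type) [AddCommGroup A] [AddGroup.FG A] :
    ∃ t : ℕ, t ≠ 0 ∧ ∀ a : A, IsOfFinAddOrder a → t • a = 0 := by
  have : Module.Finite ℤ A := Module.Finite.iff_addGroup_fg.2 inferInstance
  let T := Submodule.torsion ℤ A
  have hT : Finite T := Module.finite_of_fg_torsion T Submodule.torsion_isTorsion
  refine ⟨Nat.card T, Nat.card_pos.ne', ?_⟩
  intro a ha
  obtain ⟨n, hn, hna⟩ := isOfFinAddOrder_iff_nsmul_eq_zero.1 ha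
  have haT : a ∈ T := by
    rw [Submodule.mem_torsion_iff]
    refine ⟨⟨(n : ℤ), mem_nonZeroDivisors_of_ne_zero (by exact_mod_cast hn.ne')⟩, ?_⟩
    change (n : ℤ) • a = 0
    rw [natCast_zsmul, hna]
  have h1 : Nat.card T • (⟨a, haT⟩ : T) = 0 := card_nsmul_eq_zero'
  exact congrArg Subtype.val h1

lemma center_inf_commutator {H : Type} [Group H] (hfg : Group.FG H)
    (hsvc : StronglyVerballyClosed H) (hcomm : Finite (commutator H))
    (z : H) (hz : z ∈ Subgroup.center H) (hzc : z ∈ commutator H) : z = 1 := by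
  have hfin : Finite (commutatorSet H) :=
    (Set.Finite.subset (Set.toFinite (commutator H : Set H)) (by
      rw [commutator_eq_closure]; exact Subgroup.subset_closure)).to_subtype
  have hZfg : Group.FG (Subgroup.center H) := inferInstance
  obtain ⟨t, ht, htor⟩ := torsion_bound (Additive (Subgroup.center H))
  obtain ⟨y, hy, hyz⟩ := center_pure hfg hsvc hcomm t ht z 1 z hz hzc (by simp)
  have hzo : IsOfFinOrder z := by
    have : IsOfFinOrder (⟨z, hzc⟩ : commutator H) := isOfFinOrder_of_finite _
    exact (Subgroup.subtype (commutator H)).isOfFinOrder this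
  have hyo : IsOfFinOrder y := by
    rw [← hyz] at hzo
    exact hzo.of_pow ht
  have hyo' : IsOfFinOrder (⟨y, hy⟩ : Subgroup.center H) :=
    (Submonoid.isOfFinOrder_coe (H := (Subgroup.center H).toSubmonoid) (x := ⟨y, hy⟩)).1 hyo
  have h1 : (⟨y, hy⟩ : Subgroup.center H) ^ t = 1 :=
    htor (Additive.ofMul ⟨y, hy⟩) (isOfFinAddOrder_ofMul_iff.2 hyo')
  rw [← hyz]
  exact congrArg Subtype.val h1

end CenterDirectFactor

/-- Corollary 2: a finitely generated strongly verbally closed group with finite commutator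
subgroup (equivalently, centre of finite index) has its centre as a direct factor. -/
theorem center_direct_factor (H : Type) [Group H] (hfg : Group.FG H)
    (hsvc : StronglyVerballyClosed H) (hcomm : Finite (commutator H)) :
    ∃ K : Subgroup H, K.Normal ∧ (Subgroup.center H).IsComplement' K := by
  have hAfg : Group.FG (Abelianization H) := QuotientGroup.fg _
  let S : AddSubgroup (Additive (Abelianization H)) :=
    Subgroup.toAddSubgroup ((Subgroup.center H).map Abelianization.of)
  have hof : ∀ x y : H, Abelianization.of x = Abelianization.of y → x⁻¹ * y ∈ commutator H :=
    fun x y h => QuotientGroup.eq.1 h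
  obtain ⟨r, hr1, hr2⟩ := exists_retraction_of_pure S (by
    intro n a hn ha
    obtain ⟨x, hx⟩ := QuotientGroup.mk_surjective a.toMul
    obtain ⟨z, hz, hza⟩ : ∃ z ∈ Subgroup.center H, Abelianization.of z = a.toMul ^ n := ha
    have hx' : Abelianization.of x = a.toMul := hx
    rw [← hx', ← map_pow] at hza
    obtain ⟨y, hy, hyz⟩ := center_pure hfg hsvc hcomm n hn z x ((x ^ n)⁻¹ * z) hz
      (hof _ _ hza.symm) (by group)
    refine ⟨Additive.ofMul (Abelianization.of y), ⟨y, hy, rfl⟩, ?_⟩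
    have : Abelianization.of y ^ n = a.toMul ^ n := by
      rw [← map_pow, hyz, hza, map_pow, hx']
    exact this)
  let r' : Abelianization H →* Abelianization H := MonoidHom.toAdditive.symm r
  let R : H →* Abelianization H := r'.comp Abelianization.of
  have hR1 : ∀ x, ∃ z ∈ Subgroup.center H, Abelianization.of z = R x :=
    fun x => hr1 (Additive.ofMul (Abelianization.of x))
  have hR2 : ∀ z ∈ Subgroup.center H, R z = Abelianization.of z :=
    fun z hz => hr2 _ ⟨z, hz, rfl⟩
  refine ⟨R.ker, inferInstance, ?_⟩
  refine Subgroup.isComplement'_of_disjoint_and_mul_eq_univ ?_ ?_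
  · rw [Subgroup.disjoint_def]
    intro z hz hzk
    have h1 : R z = 1 := hzk
    rw [hR2 z hz] at h1
    exact center_inf_commutator hfg hsvc hcomm z hz ((QuotientGroup.eq_one_iff z).1 h1)
  · rw [Set.eq_univ_iff_forall]
    intro x
    obtain ⟨z, hz, hzx⟩ := hR1 x
    refine ⟨z, hz, z⁻¹ * x, ?_, by simp⟩
    change R (z⁻¹ * x) = 1
    rw [map_mul, map_inv, hR2 z hz, hzx, inv_mul_cancel]
end
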